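/- Let n be a positive integer and let α ∈ (1, p_S(n)). There is a constant C = C(n, α) > 0 such that for every nonempty open set Ω ⊆ ℝⁿ with Ω ≠ ℝⁿ and every positive solution u of Δu + u^α = 0 on Ω, one has u(x) ≤ C · dist(x, ℝⁿ \ Ω)^{−2/(α−1)} for all x ∈ Ω. -/

import Mathlib

open Set Metric

/-- Euclidean space ℝⁿ. -/
abbrev E (n : ℕ) := EuclideanSpace ℝ (Fin n)

/-- The Laplacian of `u : ℝⁿ → ℝ`: the sum of its second partial derivatives. -/
noncomputable def lap {n : ℕ} (u : E n → ℝ) (x : E n) : ℝ :=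
  ∑ i : Fin n,
    iteratedFDeriv ℝ 2 u x ![EuclideanSpace.single i 1, EuclideanSpace.single i 1]

section

open Filter Topology MeasureTheory
open scoped Convolution

variable {n : ℕ}

/-- The `i`-th partial derivative. -/
noncomputable def pd {n : ℕ} (i : Fin n) (f : E n → ℝ) (x : E n) : ℝ :=
  fderiv ℝ f x (EuclideanSpace.single i 1)

theorem pd_congr {f g : E n → ℝ} {x : E n} (h : f =ᶠ[𝓝 x] g) (i : Fin n) : pd i f x = pd i g x := by
  simp only [pd, h.fderiv_eq]

theorem pd_eventuallyEq {f g : E n → ℝ} {x : E n} (h : f =ᶠ[𝓝 x] g) (i : Fin n) :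
    pd i f =ᶠ[𝓝 x] pd i g :=
  h.eventuallyEq_nhds.mono fun _ hy => pd_congr hy i

theorem ContDiffAt.pd {f : E n → ℝ} {x : E n} {m k : ℕ} (h : ContDiffAt ℝ k f x) (hmk : m + 1 ≤ k)
    (i : Fin n) : ContDiffAt ℝ m (pd i f) x :=
  (h.fderiv_right (m := m) (by exact_mod_cast hmk)).clm_apply contDiffAt_const

theorem ContDiffAt.eventually_nat {f : E n → ℝ} {x : E n} {k : ℕ} (h : ContDiffAt ℝ k f x) :
    ∀ᶠ y in 𝓝 x, ContDiffAt ℝ k f y :=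
  h.eventually (by simp)

theorem pd_const (c : ℝ) (i : Fin n) (x : E n) : pd i (fun _ => c) x = 0 := by
  simp [pd]

theorem pd_add {f g : E n → ℝ} {x : E n} (hf : DifferentiableAt ℝ f x)
    (hg : DifferentiableAt ℝ g x) (i : Fin n) :
    pd i (fun y => f y + g y) x = pd i f x + pd i g x := by
  simp [pd, fderiv_fun_add hf hg]

theorem pd_sub {f g : E n → ℝ} {x : E n} (hf : DifferentiableAt ℝ f x)
    (hg : DifferentiableAt ℝ g x) (i : Fin n) :
    pd i (fun y => f y - g y) x = pd i f x - pd i g x := by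
  simp [pd, fderiv_fun_sub hf hg]

theorem pd_mul {f g : E n → ℝ} {x : E n} (hf : DifferentiableAt ℝ f x)
    (hg : DifferentiableAt ℝ g x) (i : Fin n) :
    pd i (fun y => f y * g y) x = f x * pd i g x + g x * pd i f x := by
  simp [pd, fderiv_fun_mul hf hg]

theorem pd_const_mul {f : E n → ℝ} {x : E n} (hf : DifferentiableAt ℝ f x) (c : ℝ) (i : Fin n) :
    pd i (fun y => c * f y) x = c * pd i f x := by
  rw [pd_mul (by fun_prop) hf, pd_const]; ring

theorem pd_sum {ι : Type*} {s : Finset ι} {f : ι → E n → ℝ} {x : E n}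
    (hf : ∀ k ∈ s, DifferentiableAt ℝ (f k) x) (i : Fin n) :
    pd i (fun y => ∑ k ∈ s, f k y) x = ∑ k ∈ s, pd i (f k) x := by
  simp [pd, fderiv_fun_sum hf]

theorem pd_comp {f : E n → ℝ} {g : ℝ → ℝ} {g' : ℝ} {x : E n} (hg : HasDerivAt g g' (f x))
    (hf : DifferentiableAt ℝ f x) (i : Fin n) :
    pd i (fun y => g (f y)) x = g' * pd i f x := by
  have := (hg.comp_hasFDerivAt x hf.hasFDerivAt).fderiv
  simp only [Function.comp_def] at this
  simp [pd, this]

theorem pd_exp {f : E n → ℝ} {x : E n} (hf : DifferentiableAt ℝ f x) (i : Fin n) :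
    pd i (fun y => Real.exp (f y)) x = Real.exp (f x) * pd i f x :=
  pd_comp (Real.hasDerivAt_exp _) hf i

theorem pd_log {f : E n → ℝ} {x : E n} (hf : DifferentiableAt ℝ f x) (h0 : f x ≠ 0) (i : Fin n) :
    pd i (fun y => Real.log (f y)) x = (f x)⁻¹ * pd i f x :=
  pd_comp (Real.hasDerivAt_log h0) hf i

theorem pd_pd_exp {f : E n → ℝ} {x : E n} (hf : ContDiffAt ℝ 2 f x) (i : Fin n) :
    pd i (pd i fun y => Real.exp (f y)) x =
      Real.exp (f x) * (pd i (pd i f) x + pd i f x ^ 2) := by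
  have h1 : (pd i fun y => Real.exp (f y)) =ᶠ[𝓝 x] fun y => Real.exp (f y) * pd i f y := by
    filter_upwards [ContDiffAt.eventually_nat (k := 2) hf] with y hy
    exact pd_exp (hy.differentiableAt (by simp)) i
  have h2 : DifferentiableAt ℝ f x := hf.differentiableAt (by simp)
  have h3 : DifferentiableAt ℝ (pd i f) x :=
    (ContDiffAt.pd (m := 1) (k := 2) hf le_rfl i).differentiableAt (by simp)
  rw [pd_congr h1, pd_mul h2.exp h3, pd_exp h2]
  ring

theorem pd_pd_log {f : E n → ℝ} {x : E n} (hf : ContDiffAt ℝ 2 f x) (h0 : f x ≠ 0) (i : Fin n) :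
    pd i (pd i fun y => Real.log (f y)) x =
      (f x)⁻¹ * pd i (pd i f) x - ((f x)⁻¹ * pd i f x) ^ 2 := by
  have h1 : (pd i fun y => Real.log (f y)) =ᶠ[𝓝 x] fun y => (f y)⁻¹ * pd i f y := by
    filter_upwards [ContDiffAt.eventually_nat (k := 2) hf, hf.continuousAt.eventually_ne h0]
      with y hy hy0
    exact pd_log (hy.differentiableAt (by simp)) hy0 i
  have h2 : DifferentiableAt ℝ f x := hf.differentiableAt (by simp)
  have h3 : DifferentiableAt ℝ (pd i f) x :=
    (ContDiffAt.pd (m := 1) (k := 2) hf le_rfl i).differentiableAt (by simp)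
  rw [pd_congr h1, pd_mul (h2.fun_inv h0) h3, pd_comp (hasDerivAt_inv h0) h2]
  field_simp
  ring

theorem pd_pd_add {f g : E n → ℝ} {x : E n} (hf : ContDiffAt ℝ 2 f x) (hg : ContDiffAt ℝ 2 g x)
    (i : Fin n) :
    pd i (pd i fun y => f y + g y) x = pd i (pd i f) x + pd i (pd i g) x := by
  have h1 : (pd i fun y => f y + g y) =ᶠ[𝓝 x] fun y => pd i f y + pd i g y := by
    filter_upwards [ContDiffAt.eventually_nat (k := 2) hf, ContDiffAt.eventually_nat (k := 2) hg]
      with y hy hy'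
    exact pd_add (hy.differentiableAt (by simp)) (hy'.differentiableAt (by simp)) i
  rw [pd_congr h1, pd_add]
  · exact (ContDiffAt.pd (m := 1) (k := 2) hf le_rfl i).differentiableAt (by simp)
  · exact (ContDiffAt.pd (m := 1) (k := 2) hg le_rfl i).differentiableAt (by simp)

theorem pd_pd_const_mul {f : E n → ℝ} {x : E n} (hf : ContDiffAt ℝ 2 f x) (c : ℝ) (i : Fin n) :
    pd i (pd i fun y => c * f y) x = c * pd i (pd i f) x := by
  have h1 : (pd i fun y => c * f y) =ᶠ[𝓝 x] fun y => c * pd i f y := by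
    filter_upwards [ContDiffAt.eventually_nat (k := 2) hf] with y hy
    exact pd_const_mul (hy.differentiableAt (by simp)) c i
  rw [pd_congr h1, pd_const_mul]
  exact (ContDiffAt.pd (m := 1) (k := 2) hf le_rfl i).differentiableAt (by simp)

theorem pd_pd_sub {f g : E n → ℝ} {x : E n} (hf : ContDiffAt ℝ 2 f x) (hg : ContDiffAt ℝ 2 g x)
    (i : Fin n) :
    pd i (pd i fun y => f y - g y) x = pd i (pd i f) x - pd i (pd i g) x := by
  have h := pd_pd_add hf (contDiffAt_const (c := (-1 : ℝ)).mul hg) i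
  rw [pd_pd_const_mul hg] at h
  simpa [sub_eq_add_neg] using h

theorem pd_pd_const (c : ℝ) (i : Fin n) (x : E n) : pd i (pd i fun _ => c) x = 0 := by
  have : (pd i fun _ : E n => c) = fun _ => 0 := funext fun y => pd_const c i y
  rw [this, pd_const]

theorem pd_pd_comm {f : E n → ℝ} {x : E n} (hf : ContDiffAt ℝ 2 f x) (i j : Fin n) :
    pd i (pd j f) x = pd j (pd i f) x := by
  have hs : IsSymmSndFDerivAt ℝ f x := hf.isSymmSndFDerivAt (by simp)
  have hd : DifferentiableAt ℝ (fderiv ℝ f) x :=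
    (hf.fderiv_right (m := 1) (by norm_num)).differentiableAt (by simp)
  have key : ∀ a b : Fin n, pd a (pd b f) x =
      fderiv ℝ (fderiv ℝ f) x (EuclideanSpace.single a 1) (EuclideanSpace.single b 1) := by
    intro a b
    unfold pd
    rw [fderiv_clm_apply hd (by fun_prop)]
    simp
  rw [key, key, hs.eq]

theorem lap_eq {f : E n → ℝ} {x : E n} (hf : ContDiffAt ℝ 2 f x) :
    lap f x = ∑ i, pd i (pd i f) x := by
  have hd : DifferentiableAt ℝ (fderiv ℝ f) x :=
    (hf.fderiv_right (m := 1) (by norm_num)).differentiableAt (by simp)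
  unfold lap
  refine Finset.sum_congr rfl fun i _ => ?_
  rw [iteratedFDeriv_two_apply]
  unfold pd
  rw [fderiv_clm_apply hd (by fun_prop)]
  simp

theorem hasDerivAt_line {f : E n → ℝ} {x : E n} {t : ℝ} (i : Fin n)
    (hf : DifferentiableAt ℝ f (x + t • EuclideanSpace.single i 1)) :
    HasDerivAt (fun s : ℝ => f (x + s • EuclideanSpace.single i 1))
      (pd i f (x + t • EuclideanSpace.single i 1)) t := by
  have h1 : HasDerivAt (fun s : ℝ => x + s • (EuclideanSpace.single i 1 : E n))
      (EuclideanSpace.single i 1) t := by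
    simpa using ((hasDerivAt_id t).smul_const (EuclideanSpace.single i 1 : E n)).const_add x
  exact hf.hasFDerivAt.comp_hasDerivAt t h1

theorem IsLocalMax.pd_eq_zero {f : E n → ℝ} {x : E n} (h : IsLocalMax f x) (i : Fin n) :
    pd i f x = 0 := by
  simp [pd, h.fderiv_eq_zero]

theorem IsLocalMax.pd_pd_nonpos {f : E n → ℝ} {x : E n} (hf : ContDiffAt ℝ 2 f x)
    (h : IsLocalMax f x) (i : Fin n) : pd i (pd i f) x ≤ 0 := by
  by_contra! hpos
  set g : ℝ → ℝ := fun s => f (x + s • EuclideanSpace.single i 1) with hg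
  have hcont : Tendsto (fun s : ℝ => x + s • (EuclideanSpace.single i 1 : E n)) (𝓝 0) (𝓝 x) := by
    have : Continuous (fun s : ℝ => x + s • (EuclideanSpace.single i 1 : E n)) := by fun_prop
    simpa using this.tendsto 0
  have hd1 : deriv g =ᶠ[𝓝 0] fun s => pd i f (x + s • EuclideanSpace.single i 1) := by
    filter_upwards [hcont.eventually (ContDiffAt.eventually_nat (k := 2) hf)] with s hs
    exact (hasDerivAt_line i (hs.differentiableAt (by simp))).deriv
  have h3 : DifferentiableAt ℝ (pd i f) x :=
    (ContDiffAt.pd (m := 1) (k := 2) hf le_rfl i).differentiableAt (by simp)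
  have hd2 : deriv (deriv g) 0 = pd i (pd i f) x := by
    rw [hd1.deriv_eq]
    have := (hasDerivAt_line (f := pd i f) (x := x) (t := 0) i (by simpa using h3)).deriv
    simpa using this
  have hd10 : deriv g 0 = 0 := by
    rw [hd1.eq_of_nhds]; simpa using h.pd_eq_zero i
  have hc : ContinuousAt g 0 := by
    have : ContinuousAt f (x + (0 : ℝ) • EuclideanSpace.single i 1) := by
      simpa using hf.continuousAt
    exact this.comp (f := fun s : ℝ => x + s • (EuclideanSpace.single i 1 : E n)) (by fun_prop)
  have hmin : IsLocalMin g 0 := isLocalMin_of_deriv_deriv_pos (by rw [hd2]; exact hpos) hd10 hc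
  have hmax : ∀ᶠ s in 𝓝 (0 : ℝ), g s ≤ g 0 := by
    have := hcont.eventually h
    simpa [hg] using this
  have hconst : g =ᶠ[𝓝 0] fun _ => g 0 := by
    filter_upwards [hmin, hmax] with s h1 h2 using le_antisymm h2 h1
  have : deriv (deriv g) 0 = 0 := by
    rw [hconst.deriv.deriv_eq]; simp
  linarith [hd2]

/-- Convolution of `g` with the normalized bump function `φ`. -/
noncomputable def mollify (φ : ContDiffBump (0 : E n)) (g : E n → ℝ) : E n → ℝ :=
  φ.normed volume ⋆[ContinuousLinearMap.lsmul ℝ ℝ, volume] g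

theorem pd_mollify (φ : ContDiffBump (0 : E n)) {g : E n → ℝ} (hg : HasCompactSupport g)
    (hg1 : ContDiff ℝ 1 g) (i : Fin n) : pd i (mollify φ g) = mollify φ (pd i g) := by
  funext x
  have hφ : LocallyIntegrable (φ.normed (volume : Measure (E n))) volume :=
    φ.continuous_normed.locallyIntegrable
  have h := hg.hasFDerivAt_convolution_right (ContinuousLinearMap.lsmul ℝ ℝ) hφ hg1 x
  unfold pd mollify
  rw [h.fderiv, convolution_precompR_apply _ hφ (hg.fderiv ℝ) (hg1.continuous_fderiv one_ne_zero)]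

theorem contDiff_mollify (φ : ContDiffBump (0 : E n)) {g : E n → ℝ} (hg : Continuous g) :
    ContDiff ℝ 3 (mollify φ g) :=
  φ.hasCompactSupport_normed.contDiff_convolution_left (n := 3) _ φ.contDiff_normed
    hg.locallyIntegrable

theorem mollify_congr (φ : ContDiffBump (0 : E n)) {g g' : E n → ℝ} {x : E n}
    (h : ∀ y ∈ ball x φ.rOut, g y = g' y) : mollify φ g x = mollify φ g' x := by
  simp only [mollify, convolution_def]
  congr 1
  funext t
  by_cases ht : t ∈ ball (0 : E n) φ.rOut
  · rw [h (x - t) (by simpa using ht)]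
  · have : φ.normed (volume : Measure (E n)) t = 0 := by
      rw [← Function.notMem_support, φ.support_normed_eq]; exact ht
    simp [this]

theorem exists_mollify_close {g : E n → ℝ} (hg : HasCompactSupport g) (hc : Continuous g) {τ : ℝ}
    (hτ : 0 < τ) :
    ∃ ε > 0, ∀ φ : ContDiffBump (0 : E n), φ.rOut < ε → ∀ x, |mollify φ g x - g x| ≤ τ := by
  obtain ⟨ε, hε, h⟩ := Metric.uniformContinuous_iff.1
    (hg.uniformContinuous_of_continuous hc) τ hτ
  refine ⟨ε, hε, fun φ hφ x => ?_⟩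
  rw [← Real.dist_eq]
  exact φ.dist_normed_convolution_le hc.aestronglyMeasurable
    fun y hy => (h ((mem_ball.1 hy).trans hφ)).le

theorem HasCompactSupport.pd {g : E n → ℝ} (hg : HasCompactSupport g) (i : Fin n) :
    HasCompactSupport (pd i g) :=
  (hg.fderiv ℝ).comp_left (g := fun l : E n →L[ℝ] ℝ => l (EuclideanSpace.single i 1)) rfl

theorem ContDiff.pd {f : E n → ℝ} {m k : ℕ} (h : ContDiff ℝ k f) (hmk : m + 1 ≤ k)
    (i : Fin n) : ContDiff ℝ m (pd i f) :=
  contDiff_iff_contDiffAt.2 fun _ => ContDiffAt.pd h.contDiffAt hmk i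

/-- Multiplication by a smooth cutoff extends a local `C^k` function to a global one. -/
theorem exists_compactSupport_extension {f : E n → ℝ} {y : E n} {R : ℝ} {k : ℕ} (hR : 0 < R)
    (hf : ∀ x ∈ ball y R, ContDiffAt ℝ k f x) :
    ∃ g : E n → ℝ, ContDiff ℝ k g ∧ HasCompactSupport g ∧ ∀ x ∈ ball y (R / 2), g x = f x := by
  let χ : ContDiffBump y := ⟨R / 2, 3 * R / 4, by positivity, by linarith⟩
  refine ⟨fun x => χ x * f x, ?_, χ.hasCompactSupport.mul_right, fun x hx => ?_⟩
  · rw [contDiff_iff_contDiffAt]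
    intro x
    by_cases hx : x ∈ ball y R
    · exact χ.contDiffAt.mul (hf x hx)
    · have hx' : x ∉ tsupport χ := by
        rw [χ.tsupport_eq]
        simp only [mem_ball, not_lt, mem_closedBall, not_le] at hx ⊢
        change 3 * R / 4 < _
        linarith
      have : (fun x => χ x * f x) =ᶠ[𝓝 x] fun _ => 0 := by
        filter_upwards [(isClosed_tsupport χ).isOpen_compl.mem_nhds hx'] with z hz
        rw [image_eq_zero_of_notMem_tsupport hz, zero_mul]
      exact contDiffAt_const.congr_of_eventuallyEq this
  · have : χ x = 1 := χ.one_of_mem_closedBall (ball_subset_closedBall hx)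
    simp [this]

/-- Smooth approximation of a `C²` function whose Laplacian is `C¹`. -/
theorem exists_smooth_approx {w L : E n → ℝ} {y : E n} (hw : ContDiffAt ℝ 2 w y)
    (hL : ContDiffAt ℝ 1 L y) (heq : ∀ᶠ x in 𝓝 y, ∑ i, pd i (pd i w) x = L x) :
    ∃ r > 0, ∀ τ > 0, ∃ W : E n → ℝ, ContDiff ℝ 3 W ∧ ∀ x ∈ ball y r,
      (∀ i, |pd i W x - pd i w x| ≤ τ) ∧ (∀ i j, |pd j (pd i W) x - pd j (pd i w) x| ≤ τ) ∧
      ∀ j, |pd j (fun z => ∑ i, pd i (pd i W) z) x - pd j L x| ≤ τ := by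
  obtain ⟨R, hR, hball⟩ := Metric.eventually_nhds_iff_ball.1
    ((ContDiffAt.eventually_nat (k := 2) hw).and
      ((ContDiffAt.eventually_nat (k := 1) hL).and heq))
  obtain ⟨g, hg, hgs, hgw⟩ := exists_compactSupport_extension (k := 2) hR
    fun x hx => (hball x hx).1
  obtain ⟨q, hq, hqs, hqL⟩ := exists_compactSupport_extension (k := 1) hR
    fun x hx => (hball x hx).2.1
  have hnear : ∀ x ∈ ball y (R / 2), g =ᶠ[𝓝 x] w := fun x hx =>
    Filter.eventuallyEq_of_mem (isOpen_ball.mem_nhds hx) hgw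
  have hnearq : ∀ x ∈ ball y (R / 2), q =ᶠ[𝓝 x] L := fun x hx =>
    Filter.eventuallyEq_of_mem (isOpen_ball.mem_nhds hx) hqL
  have hg1 : ∀ i, ContDiff ℝ 1 (pd i g) := fun i => ContDiff.pd (m := 1) (k := 2) hg le_rfl i
  have hg2 : ∀ i j, Continuous (pd j (pd i g)) := fun i j =>
    (ContDiff.pd (m := 0) (k := 1) (hg1 i) le_rfl j).continuous
  have hq1 : ∀ j, Continuous (pd j q) := fun j =>
    (ContDiff.pd (m := 0) (k := 1) hq le_rfl j).continuous
  refine ⟨R / 4, by positivity, fun τ hτ => ?_⟩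
  choose ε₁ hε₁ h₁ using fun i =>
    exists_mollify_close (hgs.pd i) (hg1 i).continuous hτ
  choose ε₂ hε₂ h₂ using fun i j =>
    exists_mollify_close ((hgs.pd i).pd j) (hg2 i j) hτ
  choose ε₃ hε₃ h₃ using fun j => exists_mollify_close (hqs.pd j) (hq1 j) hτ
  have hsmall : ∀ᶠ ε in 𝓝[>] (0 : ℝ), 0 < ε ∧ ε < R / 4 ∧ (∀ i, ε < ε₁ i) ∧
      (∀ i j, ε < ε₂ i j) ∧ ∀ j, ε < ε₃ j := by
    have hlt : ∀ {a : ℝ}, 0 < a → ∀ᶠ ε in 𝓝[>] (0 : ℝ), ε < a := fun ha =>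
      nhdsWithin_le_nhds (eventually_lt_nhds ha)
    refine eventually_mem_nhdsWithin.and ((hlt (by positivity)).and ?_)
    refine (eventually_all.2 fun i => hlt (hε₁ i)).and ?_
    exact (eventually_all.2 fun i => eventually_all.2 fun j => hlt (hε₂ i j)).and
      (eventually_all.2 fun j => hlt (hε₃ j))
  obtain ⟨ε, hε, hεR, hε1, hε2, hε3⟩ := hsmall.exists
  let φ : ContDiffBump (0 : E n) := ⟨ε / 2, ε, half_pos hε, half_lt_self hε⟩
  have hW1 : ∀ i, pd i (mollify φ g) = mollify φ (pd i g) := fun i =>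
    pd_mollify φ hgs (hg.of_le (by norm_num)) i
  have hW2 : ∀ i j, pd j (pd i (mollify φ g)) = mollify φ (pd j (pd i g)) := fun i j => by
    rw [hW1, pd_mollify φ (hgs.pd i) (hg1 i)]
  refine ⟨mollify φ g, contDiff_mollify φ hg.continuous, fun x hx => ?_⟩
  have hx2 : x ∈ ball y (R / 2) := ball_subset_ball (by linarith) hx
  refine ⟨fun i => ?_, fun i j => ?_, fun j => ?_⟩
  · rw [hW1, ← pd_congr (hnear x hx2)]
    exact h₁ i φ (hε1 i) x
  · rw [hW2, ← pd_congr (pd_eventuallyEq (hnear x hx2) i)]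
    exact h₂ i j φ (hε2 i j) x
  · have hlap : (fun z => ∑ i, pd i (pd i (mollify φ g)) z) =ᶠ[𝓝 x] mollify φ q := by
      filter_upwards [isOpen_ball.mem_nhds hx] with z hz
      have hsum : ∑ i, mollify φ (pd i (pd i g)) z =
          mollify φ (fun t => ∑ i, pd i (pd i g) t) z := by
        simp only [mollify, convolution_def, ContinuousLinearMap.lsmul_apply, smul_eq_mul,
          Finset.mul_sum]
        rw [integral_finsetSum]
        intro i _
        have := ((hgs.pd i).pd i).convolutionExists_right (μ := (volume : Measure (E n)))
          (ContinuousLinearMap.lsmul ℝ ℝ) (φ.continuous_normed (μ := (volume : Measure (E n)))).locallyIntegrable (hg2 i i) z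
        simpa [ConvolutionExistsAt] using this
      simp only [hW2, hsum]
      refine mollify_congr φ fun t ht => ?_
      have ht2 : t ∈ ball y (R / 2) := by
        have h1 : dist t z < ε := ht
        have h2 : dist z y < R / 4 := hz
        have := dist_triangle t z y
        rw [mem_ball]; linarith
      rw [hqL t ht2, ← (hball t (ball_subset_ball (by linarith) ht2)).2.2]
      exact Finset.sum_congr rfl fun i _ => pd_congr (pd_eventuallyEq (hnear t ht2) i) i
    rw [pd_congr hlap, pd_mollify φ hqs hq, ← pd_congr (hnearq x hx2)]
    exact h₃ j φ (hε3 j) x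

theorem pd_pd_sum {ι : Type*} {s : Finset ι} {f : ι → E n → ℝ} {x : E n}
    (hf : ∀ k ∈ s, ContDiffAt ℝ 2 (f k) x) (i : Fin n) :
    pd i (pd i fun y => ∑ k ∈ s, f k y) x = ∑ k ∈ s, pd i (pd i (f k)) x := by
  have h1 : (pd i fun y => ∑ k ∈ s, f k y) =ᶠ[𝓝 x] fun y => ∑ k ∈ s, pd i (f k) y := by
    have : ∀ᶠ y in 𝓝 x, ∀ k ∈ s, ContDiffAt ℝ 2 (f k) y :=
      (eventually_all_finset s).2 fun k hk => ContDiffAt.eventually_nat (k := 2) (hf k hk)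
    filter_upwards [this] with y hy
    exact pd_sum (fun k hk => (hy k hk).differentiableAt (by simp)) i
  rw [pd_congr h1, pd_sum]
  exact fun k hk =>
    (ContDiffAt.pd (m := 1) (k := 2) (hf k hk) le_rfl i).differentiableAt (by simp)

theorem pd_pd_sq {f : E n → ℝ} {x : E n} (hf : ContDiffAt ℝ 2 f x) (i : Fin n) :
    pd i (pd i fun y => f y ^ 2) x = 2 * pd i f x ^ 2 + 2 * (f x * pd i (pd i f) x) := by
  have h1 : (pd i fun y => f y ^ 2) =ᶠ[𝓝 x] fun y => 2 * (f y * pd i f y) := by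
    filter_upwards [ContDiffAt.eventually_nat (k := 2) hf] with y hy
    have hd : DifferentiableAt ℝ f y := hy.differentiableAt (by simp)
    simp only [sq]
    rw [pd_mul hd hd]
    ring
  have h2 : DifferentiableAt ℝ f x := hf.differentiableAt (by simp)
  have h3 : DifferentiableAt ℝ (pd i f) x :=
    (ContDiffAt.pd (m := 1) (k := 2) hf le_rfl i).differentiableAt (by simp)
  rw [pd_congr h1, pd_const_mul (h2.fun_mul h3), pd_mul h2 h3]
  ring

theorem pd_sq {f : E n → ℝ} {x : E n} (hf : DifferentiableAt ℝ f x) (i : Fin n) :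
    pd i (fun y => f y ^ 2) x = 2 * (f x * pd i f x) := by
  simp only [sq]
  rw [pd_mul hf hf]
  ring

/-- The squared distance to `y`, in coordinates. -/
noncomputable def sqDist (y x : E n) : ℝ := ∑ k, (x k - y k) ^ 2

theorem sqDist_eq (y x : E n) : sqDist y x = dist x y ^ 2 := by
  rw [EuclideanSpace.dist_eq, Real.sq_sqrt (by positivity)]
  simp [sqDist, Real.dist_eq, sq_abs]

theorem contDiff_sqDist (y : E n) {m : WithTop ℕ∞} : ContDiff ℝ m (sqDist y) := by
  unfold sqDist
  fun_prop

theorem pd_sqDist (y : E n) (i : Fin n) : pd i (sqDist y) = fun x => 2 * (x i - y i) := by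
  funext x
  have hk : ∀ k : Fin n, DifferentiableAt ℝ (fun x : E n => x k - y k) x := by
    intro k; fun_prop
  have hpd : ∀ k : Fin n, pd i (fun x : E n => x k - y k) x = if k = i then 1 else 0 := by
    intro k
    have : HasFDerivAt (fun x : E n => x k - y k)
        (EuclideanSpace.proj k : E n →L[ℝ] ℝ) x :=
      (EuclideanSpace.proj k : E n →L[ℝ] ℝ).hasFDerivAt.sub_const _
    simp [pd, this.fderiv]
  unfold sqDist
  rw [pd_sum (fun k _ => (hk k).fun_pow 2)]
  simp_rw [pd_sq (hk _), hpd]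
  simp

theorem pd_pd_sqDist (y : E n) (i : Fin n) (x : E n) : pd i (pd i (sqDist y)) x = 2 := by
  have : HasFDerivAt (fun x : E n => 2 * (x i - y i))
      ((2 : ℝ) • (EuclideanSpace.proj i : E n →L[ℝ] ℝ)) x :=
    ((EuclideanSpace.proj i : E n →L[ℝ] ℝ).hasFDerivAt.sub_const _).const_mul _
  rw [pd_sqDist, pd, this.fderiv]
  simp

/-- Bochner's formula in coordinates. -/
theorem sum_pd_pd_grad_sq {W : E n → ℝ} (hW : ContDiff ℝ 3 W) (x : E n) :
    ∑ j, pd j (pd j fun z => ∑ i, pd i W z ^ 2) x =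
      2 * ∑ i, ∑ j, pd j (pd i W) x ^ 2 +
        2 * ∑ i, pd i W x * pd i (fun z => ∑ j, pd j (pd j W) z) x := by
  have h2 : ∀ i, ContDiff ℝ 2 (pd i W) := fun i => ContDiff.pd (m := 2) (k := 3) hW le_rfl i
  have h1 : ∀ i j, ContDiff ℝ 1 (pd j (pd i W)) := fun i j =>
    ContDiff.pd (m := 1) (k := 2) (h2 i) le_rfl j
  have hcomm : ∀ i j, pd j (pd j (pd i W)) x = pd i (pd j (pd j W)) x := by
    intro i j
    have : pd j (pd i W) = pd i (pd j W) := funext fun z =>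
      pd_pd_comm (hW.of_le (by norm_num)).contDiffAt j i
    rw [this, pd_pd_comm (h2 j).contDiffAt]
  have hl : ∀ i, pd i (fun z => ∑ j, pd j (pd j W) z) x = ∑ j, pd j (pd j (pd i W)) x := by
    intro i
    rw [pd_sum fun j _ => ((h1 j j).differentiable (by simp)).differentiableAt]
    exact Finset.sum_congr rfl fun j _ => (hcomm i j).symm
  have hj : ∀ j, pd j (pd j fun z => ∑ i, pd i W z ^ 2) x =
      ∑ i, (2 * pd j (pd i W) x ^ 2 + 2 * (pd i W x * pd j (pd j (pd i W)) x)) := by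
    intro j
    rw [pd_pd_sum fun i _ => (h2 i).contDiffAt.pow 2]
    exact Finset.sum_congr rfl fun i _ => pd_pd_sq (h2 i).contDiffAt j
  simp_rw [hj, hl]
  rw [Finset.sum_comm]
  simp_rw [Finset.sum_add_distrib, ← Finset.mul_sum]

theorem exists_approx_max {w S L : E n → ℝ} {y : E n} (hw : ContDiffAt ℝ 2 w y)
    (hS : ContDiffAt ℝ 2 S y) (hL : ContDiffAt ℝ 1 L y)
    (heq : ∀ᶠ x in 𝓝 y, ∑ i, pd i (pd i w) x = L x)
    (hmax : IsLocalMax (fun x => ∑ i, pd i w x ^ 2 + S x) y) {τ : ℝ} (hτ : 0 < τ) :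
    ∃ (z : E n) (W : E n → ℝ), dist z y ≤ τ ∧
      (∀ i, |pd i W z - pd i w z| ≤ τ) ∧ (∀ i j, |pd j (pd i W) z - pd j (pd i w) z| ≤ τ) ∧
      (∀ j, |pd j (fun z => ∑ i, pd i (pd i W) z) z - pd j L z| ≤ τ) ∧
      2 * ∑ i, ∑ j, pd j (pd i W) z ^ 2 +
        2 * ∑ i, pd i W z * pd i (fun z => ∑ j, pd j (pd j W) z) z +
        ∑ i, pd i (pd i S) z ≤ 2 * n * τ := by
  obtain ⟨r, hr, happ⟩ := exists_smooth_approx hw hL heq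
  obtain ⟨r', hr', hball⟩ := Metric.eventually_nhds_iff_ball.1
    (((ContDiffAt.eventually_nat (k := 2) hw).and
      (ContDiffAt.eventually_nat (k := 2) hS)).and hmax)
  obtain ⟨ρ, hρ, hρτ, hρr, hρr'⟩ : ∃ ρ > 0, ρ ≤ τ ∧ ρ < r ∧ ρ < r' :=
    ⟨min τ (min r r' / 2), by positivity, min_le_left _ _,
      (min_le_right _ _).trans_lt (by have := min_le_left r r'; have := lt_min hr hr'; linarith),
      (min_le_right _ _).trans_lt (by have := min_le_right r r'; have := lt_min hr hr'; linarith)⟩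
  have hsub : closedBall y ρ ⊆ ball y r' := closedBall_subset_ball hρr'
  have hcw : ∀ i, ContinuousOn (pd i w) (closedBall y ρ) := fun i x hx =>
    (ContDiffAt.pd (m := 1) (k := 2) (hball x (hsub hx)).1.1 le_rfl i).continuousAt.continuousWithinAt
  have hcS : ContinuousOn S (closedBall y ρ) := fun x hx =>
    (hball x (hsub hx)).1.2.continuousAt.continuousWithinAt
  choose M hM using fun i => (isCompact_closedBall y ρ).exists_bound_of_continuousOn (hcw i)
  obtain ⟨σ, hσ, hστ, hσM⟩ : ∃ σ > 0, σ ≤ τ ∧ ∑ i : Fin n, σ * (2 * |M i| + σ) < τ * ρ ^ 2 / 2 := by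
    have hlim : Tendsto (fun σ : ℝ => ∑ i : Fin n, σ * (2 * |M i| + σ)) (𝓝[>] 0) (𝓝 0) := by
      have : Continuous fun σ : ℝ => ∑ i : Fin n, σ * (2 * |M i| + σ) := by fun_prop
      simpa using (this.tendsto 0).mono_left nhdsWithin_le_nhds
    obtain ⟨σ, h1, h2, h3⟩ := (eventually_mem_nhdsWithin.and
      (((eventually_le_nhds hτ).filter_mono nhdsWithin_le_nhds).and
      (hlim.eventually_lt_const (show 0 < τ * ρ ^ 2 / 2 by positivity)))).exists
    exact ⟨σ, h1, h2, h3⟩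
  obtain ⟨W, hW, hWc⟩ := happ σ hσ
  have hgrad : ∀ x ∈ closedBall y ρ,
      |∑ i, pd i W x ^ 2 - ∑ i, pd i w x ^ 2| < τ * ρ ^ 2 / 2 := by
    intro x hx
    rw [← Finset.sum_sub_distrib]
    refine (Finset.abs_sum_le_sum_abs _ _).trans_lt (lt_of_le_of_lt ?_ hσM)
    refine Finset.sum_le_sum fun i _ => ?_
    have h1 := (hWc x (closedBall_subset_ball hρr hx)).1 i
    have h2 : |pd i w x| ≤ |M i| := (hM i x hx).trans (le_abs_self _)
    have h3 : pd i W x ^ 2 - pd i w x ^ 2 =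
        (pd i W x - pd i w x) * ((pd i W x - pd i w x) + 2 * pd i w x) := by ring
    rw [h3, abs_mul]
    refine mul_le_mul h1 ?_ (abs_nonneg _) hσ.le
    refine (abs_add_le _ _).trans ?_
    rw [abs_mul, abs_two]
    linarith
  have hW1 : ∀ i, ContDiff ℝ 2 (pd i W) := fun i => ContDiff.pd (m := 2) (k := 3) hW le_rfl i
  set f : E n → ℝ := fun x => (∑ i, pd i W x ^ 2 + S x) - τ * sqDist y x with hf
  have hfc : ContinuousOn f (closedBall y ρ) := by
    refine ContinuousOn.sub (ContinuousOn.add ?_ hcS) ?_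
    · exact (continuous_finsetSum _ fun i _ => (hW1 i).continuous.pow 2).continuousOn
    · exact (continuous_const.mul (contDiff_sqDist (m := 0) y).continuous).continuousOn
  obtain ⟨z, hz, hzmax⟩ := (isCompact_closedBall y ρ).exists_isMaxOn
    ⟨y, mem_closedBall_self hρ.le⟩ hfc
  have hzy : dist z y < ρ := by
    refine lt_of_le_of_ne hz fun hzρ => ?_
    have h1 : f y ≤ f z := hzmax (mem_closedBall_self hρ.le)
    have h2 : ∑ i, pd i w z ^ 2 + S z ≤ ∑ i, pd i w y ^ 2 + S y := (hball z (hsub hz)).2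
    have h3 := abs_lt.1 (hgrad z hz)
    have h4 := abs_lt.1 (hgrad y (mem_closedBall_self hρ.le))
    simp only [hf, sqDist_eq, hzρ, dist_self] at h1
    linarith [h3.2, h4.1]
  have hlm : IsLocalMax f z :=
    Filter.eventually_of_mem (isOpen_ball.mem_nhds hzy) fun x hx =>
      hzmax (ball_subset_closedBall hx)
  have hSz := (hball z (hsub hz)).1.2
  have hG2 : ContDiffAt ℝ 2 (fun x => ∑ i, pd i W x ^ 2) z :=
    ContDiffAt.sum fun i _ => (hW1 i).contDiffAt.pow 2
  have hP2 : ContDiffAt ℝ 2 (fun x => τ * sqDist y x) z :=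
    contDiffAt_const.mul (contDiff_sqDist y).contDiffAt
  have hle : ∑ j, pd j (pd j f) z ≤ 0 := Finset.sum_nonpos fun j _ =>
    hlm.pd_pd_nonpos ((hG2.add hSz).sub hP2) j
  have hexp : ∀ j, pd j (pd j f) z =
      pd j (pd j fun x => ∑ i, pd i W x ^ 2) z + pd j (pd j S) z - τ * 2 := by
    intro j
    rw [hf, pd_pd_sub (hG2.add hSz) hP2, pd_pd_add hG2 hSz,
      pd_pd_const_mul (contDiff_sqDist y).contDiffAt, pd_pd_sqDist]
  simp_rw [hexp] at hle
  rw [Finset.sum_sub_distrib, Finset.sum_add_distrib, sum_pd_pd_grad_sq hW] at hle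
  obtain ⟨c1, c2, c3⟩ := hWc z (closedBall_subset_ball hρr hz)
  refine ⟨z, W, hzy.le.trans hρτ, fun i => (c1 i).trans hστ, fun i j => (c2 i j).trans hστ,
    fun j => (c3 j).trans hστ, ?_⟩
  simp at hle
  linarith

/-- The first and second order conditions at a local maximum of `|∇w|² + S`, where `w` is only
`C²` but its Laplacian `L` is `C¹`. -/
theorem bochner_at_max {w S L : E n → ℝ} {y : E n} (hw : ContDiffAt ℝ 2 w y)
    (hS : ContDiffAt ℝ 2 S y) (hL : ContDiffAt ℝ 1 L y)
    (heq : ∀ᶠ x in 𝓝 y, ∑ i, pd i (pd i w) x = L x)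
    (hmax : IsLocalMax (fun x => ∑ i, pd i w x ^ 2 + S x) y) :
    (∀ j, 2 * ∑ i, pd i w y * pd j (pd i w) y + pd j S y = 0) ∧
    2 * ∑ i, ∑ j, pd j (pd i w) y ^ 2 + 2 * ∑ i, pd i w y * pd i L y +
      ∑ i, pd i (pd i S) y ≤ 0 := by
  have hw1 : ∀ i, ContDiffAt ℝ 1 (pd i w) y := fun i =>
    ContDiffAt.pd (m := 1) (k := 2) hw le_rfl i
  have hw2 : ∀ i j, ContinuousAt (pd j (pd i w)) y := fun i j =>
    (ContDiffAt.pd (m := 0) (k := 1) (hw1 i) le_rfl j).continuousAt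
  have hS2 : ∀ i, ContinuousAt (pd i (pd i S)) y := fun i =>
    (ContDiffAt.pd (m := 0) (k := 1) (ContDiffAt.pd (m := 1) (k := 2) hS le_rfl i)
      le_rfl i).continuousAt
  have hL1 : ∀ i, ContinuousAt (pd i L) y := fun i =>
    (ContDiffAt.pd (m := 0) (k := 1) hL le_rfl i).continuousAt
  constructor
  · intro j
    have h := hmax.pd_eq_zero j
    have hd : ∀ i, DifferentiableAt ℝ (pd i w) y := fun i => (hw1 i).differentiableAt (by simp)
    rw [pd_add (DifferentiableAt.fun_sum fun i _ => (hd i).fun_pow 2)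
      (hS.differentiableAt (by simp)), pd_sum fun i _ => (hd i).fun_pow 2] at h
    simp_rw [pd_sq (hd _)] at h
    rw [← h, Finset.mul_sum]
  · have hτ : ∀ m : ℕ, (0 : ℝ) < 1 / (m + 1) := fun m => by positivity
    have hτ0 : Tendsto (fun m : ℕ => 1 / ((m : ℝ) + 1)) atTop (𝓝 0) :=
      tendsto_one_div_add_atTop_nhds_zero_nat
    choose z W h0 h1 h2 h3 h4 using fun m => exists_approx_max hw hS hL heq hmax (hτ m)
    have hz : Tendsto z atTop (𝓝 y) := by
      rw [tendsto_iff_dist_tendsto_zero]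
      exact squeeze_zero (fun _ => dist_nonneg) h0 hτ0
    have key : ∀ {a b : ℕ → ℝ} {l : ℝ}, (∀ m : ℕ, |a m - b m| ≤ 1 / ((m : ℝ) + 1)) →
        Tendsto b atTop (𝓝 l) → Tendsto a atTop (𝓝 l) := by
      intro a b l hab hb
      have : Tendsto (fun m => a m - b m) atTop (𝓝 0) :=
        squeeze_zero_norm (fun m => by simpa using hab m) hτ0
      simpa using this.add hb
    have t1 : ∀ i, Tendsto (fun m => pd i (W m) (z m)) atTop (𝓝 (pd i w y)) := fun i =>
      key (fun m => h1 m i) ((hw1 i).continuousAt.tendsto.comp hz)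
    have t2 : ∀ i j, Tendsto (fun m => pd j (pd i (W m)) (z m)) atTop (𝓝 (pd j (pd i w) y)) :=
      fun i j => key (fun m => h2 m i j) ((hw2 i j).tendsto.comp hz)
    have t3 : ∀ j, Tendsto (fun m => pd j (fun x => ∑ i, pd i (pd i (W m)) x) (z m)) atTop
        (𝓝 (pd j L y)) := fun j => key (fun m => h3 m j) ((hL1 j).tendsto.comp hz)
    have t4 : ∀ j, Tendsto (fun m => pd j (pd j S) (z m)) atTop (𝓝 (pd j (pd j S) y)) :=
      fun j => (hS2 j).tendsto.comp hz
    have tl := (((tendsto_finsetSum Finset.univ fun i _ =>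
      tendsto_finsetSum Finset.univ fun j _ => (t2 i j).pow 2).const_mul 2).add
      ((tendsto_finsetSum Finset.univ fun i _ => (t1 i).mul (t3 i)).const_mul 2)).add
      (tendsto_finsetSum Finset.univ fun i _ => t4 i)
    have tr := hτ0.const_mul (2 * (n : ℝ))
    rw [mul_zero] at tr
    exact le_of_tendsto_of_tendsto' tl tr h4

/-- The algebraic lower bound for `|A|²` in terms of the trace of `A` and `⟨A p, p⟩`. -/
theorem sum_sq_lower_bound (A : Fin n → Fin n → ℝ) (p : Fin n → ℝ) (a b : ℝ) :
    2 * a * ∑ i, A i i + 2 * b * ∑ j, p j * ∑ i, p i * A i j -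
      (n * a ^ 2 + 2 * a * b * ∑ i, p i ^ 2 + b ^ 2 * (∑ i, p i ^ 2) ^ 2) ≤
      ∑ i, ∑ j, A i j ^ 2 := by
  have h0 : 0 ≤ ∑ i, ∑ j, (A i j - (if i = j then a else 0) - b * (p i * p j)) ^ 2 := by
    positivity
  have h1 : ∀ i j, (A i j - (if i = j then a else 0) - b * (p i * p j)) ^ 2 =
      A i j ^ 2 - (if i = j then 2 * a * A i j else 0) + (if i = j then a ^ 2 else 0)
        + (if i = j then 2 * a * b * (p i * p j) else 0) - 2 * b * (p j * (p i * A i j))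
        + b ^ 2 * (p i ^ 2 * p j ^ 2) := by
    intro i j
    split_ifs <;> ring
  have h2 : ∑ i, ∑ j, p j * (p i * A i j) = ∑ j, p j * ∑ i, p i * A i j := by
    rw [Finset.sum_comm]
    simp_rw [Finset.mul_sum]
  have h3 : ∑ i, ∑ j, p i ^ 2 * p j ^ 2 = (∑ i, p i ^ 2) ^ 2 := by
    rw [sq, Finset.sum_mul_sum]
  have h4 : ∑ i, p i * p i = ∑ i, p i ^ 2 := Finset.sum_congr rfl fun i _ => (sq _).symm
  simp only [h1, Finset.sum_add_distrib, Finset.sum_sub_distrib] at h0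
  have h5 : ∑ i, ∑ j, 2 * b * (p j * (p i * A i j)) =
      2 * b * ∑ j, p j * ∑ i, p i * A i j := by
    rw [← h2, Finset.mul_sum]
    exact Finset.sum_congr rfl fun i _ => (Finset.mul_sum _ _ _).symm
  have h6 : ∑ i, ∑ j, b ^ 2 * (p i ^ 2 * p j ^ 2) = b ^ 2 * (∑ i, p i ^ 2) ^ 2 := by
    rw [← h3, Finset.mul_sum]
    exact Finset.sum_congr rfl fun i _ => (Finset.mul_sum _ _ _).symm
  rw [h5, h6] at h0
  simp only [Finset.sum_ite_eq, Finset.mem_univ, if_true, ← Finset.mul_sum, h4,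
    Finset.sum_const, Finset.card_univ, Fintype.card_fin, nsmul_eq_mul] at h0
  linarith

/-- The quadratic form in `G = |∇ log u|²` and `h = u^k` governing the differential inequality for
`u^{-β} (G + c h)`. -/
noncomputable def bernsteinForm (N k β c a₁ a₂ b G h : ℝ) : ℝ :=
  -4 * (a₁ * G + a₂ * h) * (G + h) - 2 * N * (a₁ * G + a₂ * h) ^ 2 -
    4 * (a₁ * G + a₂ * h) * b * G - 2 * b ^ 2 * G ^ 2 +
    (2 * b - 2) * (β * (G + c * h) - c * k * h) * G - 2 * k * h * G +
    c * h * (-k * (G + h) + k ^ 2 * G) - (G + c * h) * (-β * (G + h) + β ^ 2 * G)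

theorem bernstein_algebra {N k β c a₁ a₂ b h H z : ℝ} (hN : (n : ℝ) ≤ N)
    (A : Fin n → Fin n → ℝ) (p q : Fin n → ℝ) (hH : H = ∑ i, p i ^ 2 + c * h)
    (htr : ∑ i, A i i = -(∑ i, p i ^ 2) - h)
    (h1 : ∀ j, 2 * ∑ i, p i * A i j + (c * k * h * p j - H * (β * p j - 2 * q j)) = 0)
    (h2 : 2 * ∑ i, ∑ j, A i j ^ 2 + 2 * ∑ j, p j * (-2 * ∑ i, p i * A i j - k * h * p j) +
      (c * h * (k * (-(∑ i, p i ^ 2) - h) + k ^ 2 * ∑ i, p i ^ 2) -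
        H * (β * (-(∑ i, p i ^ 2) - h) - 2 * z + ∑ j, (β * p j - 2 * q j) ^ 2)) ≤ 0) :
    bernsteinForm N k β c a₁ a₂ b (∑ i, p i ^ 2) h ≤
      H * ((4 * b - 4 - 4 * β) * ∑ j, p j * q j - 2 * z + 4 * ∑ j, q j ^ 2) := by
  have hA := sum_sq_lower_bound A p (a₁ * ∑ i, p i ^ 2 + a₂ * h) b
  set G := ∑ i, p i ^ 2 with hG
  set P := ∑ j, p j * ∑ i, p i * A i j with hP
  set X := ∑ j, p j * q j with hX
  set Q := ∑ j, q j ^ 2 with hQ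
  have e1 : 2 * P + (c * k * h * G - H * (β * G - 2 * X)) = 0 := by
    have : ∑ j, p j * (2 * ∑ i, p i * A i j + (c * k * h * p j - H * (β * p j - 2 * q j))) = 0 :=
      Finset.sum_eq_zero fun j _ => by rw [h1 j, mul_zero]
    rw [← this, hP, hG, hX]
    simp only [Finset.mul_sum, ← Finset.sum_add_distrib, ← Finset.sum_sub_distrib]
    refine Finset.sum_congr rfl fun j _ => ?_
    rw [← Finset.mul_sum, ← Finset.mul_sum, ← Finset.mul_sum]
    ring
  have e2 : ∑ j, p j * (-2 * ∑ i, p i * A i j - k * h * p j) = -2 * P - k * h * G := by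
    rw [hP, hG, Finset.mul_sum, Finset.mul_sum, ← Finset.sum_sub_distrib]
    exact Finset.sum_congr rfl fun j _ => by ring
  have e3 : ∑ j, (β * p j - 2 * q j) ^ 2 = β ^ 2 * G - 4 * β * X + 4 * Q := by
    rw [hG, hX, hQ, Finset.mul_sum, Finset.mul_sum, Finset.mul_sum, ← Finset.sum_sub_distrib,
      ← Finset.sum_add_distrib]
    exact Finset.sum_congr rfl fun j _ => by ring
  rw [e2, e3] at h2
  rw [htr] at hA
  have hn : (n : ℝ) * (a₁ * G + a₂ * h) ^ 2 ≤ N * (a₁ * G + a₂ * h) ^ 2 :=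
    mul_le_mul_of_nonneg_right hN (sq_nonneg _)
  have eP : P = (H * (β * G - 2 * X) - c * k * h * G) / 2 := by linarith
  rw [eP] at hA h2
  subst hH
  unfold bernsteinForm
  linarith

theorem bernstein_final {δ c κ s G H X Q D : ℝ} (hδ : 0 < δ) (hc : 0 < c) (hs : 0 < s)
    (hGs : G ≤ s) (hH : 0 < H) (hHs : H ≤ (1 + c) * s)
    (hX : ∀ η > 0, κ * X ≤ η * G + κ ^ 2 / (4 * η) * Q)
    (h : δ * s ^ 2 ≤ H * (κ * X + D)) :
    s ≤ 2 * (1 + c) / δ * (κ ^ 2 * (1 + c) / (2 * δ) * Q + D) := by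
  have hB : 0 < κ * X + D := by
    by_contra! hneg
    have := mul_nonpos_of_nonneg_of_nonpos hH.le hneg
    have : 0 < δ * s ^ 2 := by positivity
    linarith
  have h1 : δ * s ^ 2 ≤ (1 + c) * s * (κ * X + D) :=
    h.trans (mul_le_mul_of_nonneg_right hHs hB.le)
  have h2 : δ * s ≤ (1 + c) * (κ * X + D) := by
    refine le_of_mul_le_mul_right ?_ hs
    linarith
  have h3 := hX (δ / (2 * (1 + c))) (by positivity)
  have h4 : δ / (2 * (1 + c)) * G ≤ δ / (2 * (1 + c)) * s :=
    mul_le_mul_of_nonneg_left hGs (by positivity)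
  have h5 : (1 + c) * (κ * X + D) ≤
      (1 + c) * (δ / (2 * (1 + c)) * s + κ ^ 2 / (4 * (δ / (2 * (1 + c)))) * Q + D) :=
    mul_le_mul_of_nonneg_left (by linarith) (by positivity)
  have h6 : (1 + c) * (δ / (2 * (1 + c)) * s) = δ / 2 * s := by field_simp
  have h7 : κ ^ 2 / (4 * (δ / (2 * (1 + c)))) = κ ^ 2 * (1 + c) / (2 * δ) := by
    field_simp; norm_num
  rw [h7] at h5
  have h8 : δ / 2 * s ≤ (1 + c) * (κ ^ 2 * (1 + c) / (2 * δ) * Q + D) := by linarith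
  calc s = 2 / δ * (δ / 2 * s) := by field_simp
    _ ≤ 2 / δ * ((1 + c) * (κ ^ 2 * (1 + c) / (2 * δ) * Q + D)) :=
      mul_le_mul_of_nonneg_left h8 (by positivity)
    _ = _ := by ring

theorem mul_sum_le_young (p q : Fin n → ℝ) (κ : ℝ) {η : ℝ} (hη : 0 < η) :
    κ * ∑ j, p j * q j ≤ η * ∑ j, p j ^ 2 + κ ^ 2 / (4 * η) * ∑ j, q j ^ 2 := by
  rw [Finset.mul_sum, Finset.mul_sum, Finset.mul_sum, ← Finset.sum_add_distrib]
  refine Finset.sum_le_sum fun j _ => ?_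
  have h : η * p j ^ 2 + κ ^ 2 / (4 * η) * q j ^ 2 - κ * (p j * q j) =
      η * (p j - κ / (2 * η) * q j) ^ 2 := by
    field_simp; ring
  have : 0 ≤ η * (p j - κ / (2 * η) * q j) ^ 2 := by positivity
  linarith

/-- `w` is of class `C²` near `x` and solves the equation satisfied by `log u` at `x`, where
`Δu + u^{k+1} = 0`. -/
def LogSol (k : ℝ) (w : E n → ℝ) (x : E n) : Prop :=
  ContDiffAt ℝ 2 w x ∧ ∑ i, pd i (pd i w) x = -(∑ i, pd i w x ^ 2) - Real.exp (k * w x)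

theorem pd_logSol_rhs {k : ℝ} {w : E n → ℝ} {y : E n} (hw : ContDiffAt ℝ 2 w y) (j : Fin n) :
    pd j (fun x => -(∑ i, pd i w x ^ 2) - Real.exp (k * w x)) y =
      -2 * ∑ i, pd i w y * pd j (pd i w) y - k * Real.exp (k * w y) * pd j w y := by
  have hd : DifferentiableAt ℝ w y := hw.differentiableAt (by simp)
  have hp : ∀ i, DifferentiableAt ℝ (pd i w) y := fun i =>
    (ContDiffAt.pd (m := 1) (k := 2) hw le_rfl i).differentiableAt (by simp)
  have hp2 : ∀ i ∈ Finset.univ, DifferentiableAt ℝ (fun x => pd i w x ^ 2) y := fun i _ =>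
    (hp i).fun_pow 2
  have hs : DifferentiableAt ℝ (fun x => ∑ i, pd i w x ^ 2) y := DifferentiableAt.fun_sum hp2
  have e1 : (fun x => -(∑ i, pd i w x ^ 2) - Real.exp (k * w x)) =
      fun x => (-1) * (∑ i, pd i w x ^ 2) - Real.exp (k * w x) := by
    funext x; ring
  rw [e1, pd_sub (hs.const_mul _) (hd.const_mul k).exp, pd_const_mul hs, pd_sum hp2,
    pd_exp (hd.const_mul k), pd_const_mul hd]
  simp_rw [pd_sq (hp _)]
  rw [← Finset.mul_sum]
  ring

/-- Bernstein's estimate at an interior maximum of `ζ² u^{-β} (|∇ log u|² + c u^k)`. -/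
theorem bernstein_at_max {N k β c a₁ a₂ b δ : ℝ} (hN : (n : ℝ) ≤ N) (hc : 0 < c) (hδ : 0 < δ)
    (hQ : ∀ G h : ℝ, 0 ≤ G → 0 ≤ h → δ * (G + h) ^ 2 ≤ bernsteinForm N k β c a₁ a₂ b G h)
    {w ζ : E n → ℝ} {y : E n} (hw : ∀ᶠ x in 𝓝 y, LogSol k w x) (hζ : ContDiffAt ℝ 2 ζ y)
    (hζ0 : 0 < ζ y)
    (hmax : IsLocalMax (fun x => ζ x ^ 2 * Real.exp (-(β * w x)) *
      (∑ i, pd i w x ^ 2 + c * Real.exp (k * w x))) y) :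
    ∑ i, pd i w y ^ 2 + Real.exp (k * w y) ≤
      2 * (1 + c) / δ * ((4 * b - 4 - 4 * β) ^ 2 * (1 + c) / (2 * δ) *
          ∑ j, ((ζ y)⁻¹ * pd j ζ y) ^ 2 +
        (6 * ∑ j, ((ζ y)⁻¹ * pd j ζ y) ^ 2 - 2 * ((ζ y)⁻¹ * ∑ j, pd j (pd j ζ) y))) := by
  have hwy := hw.self_of_nhds
  have hwd : DifferentiableAt ℝ w y := hwy.1.differentiableAt (by simp)
  have hζd : DifferentiableAt ℝ ζ y := hζ.differentiableAt (by simp)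
  have hG0 : ∀ x, 0 ≤ ∑ i, pd i w x ^ 2 := fun x => by positivity
  set H := ∑ i, pd i w y ^ 2 + c * Real.exp (k * w y) with hH
  have hHpos : 0 < H := by have := hG0 y; positivity
  set Λ := ζ y ^ 2 * Real.exp (-(β * w y)) * H with hΛ
  have hΛpos : 0 < Λ := by positivity
  set F : E n → ℝ := fun x => β * w x - 2 * Real.log (ζ x) + Real.log Λ with hF
  have hexpF : ∀ x, 0 < ζ x → Real.exp (F x) = Λ / (ζ x ^ 2 * Real.exp (-(β * w x))) := by
    intro x hx
    rw [hF]
    simp only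
    rw [Real.exp_add, Real.exp_log hΛpos, Real.exp_sub, Real.exp_neg, two_mul, Real.exp_add,
      Real.exp_log hx]
    field_simp
  have hFy : Real.exp (F y) = H := by
    rw [hexpF y hζ0, hΛ]
    field_simp
  have hlog : ContDiffAt ℝ 2 (fun x => Real.log (ζ x)) y := hζ.log hζ0.ne'
  have h2log : ContDiffAt ℝ 2 (fun x => 2 * Real.log (ζ x)) y := contDiffAt_const.mul hlog
  have hβw : ContDiffAt ℝ 2 (fun x => β * w x) y := contDiffAt_const.mul hwy.1
  have hkw : ContDiffAt ℝ 2 (fun x => k * w x) y := contDiffAt_const.mul hwy.1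
  have hsub : ContDiffAt ℝ 2 (fun x => β * w x - 2 * Real.log (ζ x)) y := hβw.sub h2log
  have hFc : ContDiffAt ℝ 2 F y := hsub.add contDiffAt_const
  have hek : ContDiffAt ℝ 2 (fun x => Real.exp (k * w x)) y := hkw.exp
  have hcek : ContDiffAt ℝ 2 (fun x => c * Real.exp (k * w x)) y := contDiffAt_const.mul hek
  have heF : ContDiffAt ℝ 2 (fun x => Real.exp (F x)) y := hFc.exp
  have hpdF : ∀ j, pd j F y = β * pd j w y - 2 * ((ζ y)⁻¹ * pd j ζ y) := by
    intro j
    rw [hF, pd_add (hsub.differentiableAt (by simp)) (by fun_prop), pd_const,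
      pd_sub (hβw.differentiableAt (by simp)) (h2log.differentiableAt (by simp)),
      pd_const_mul hwd, pd_const_mul (hlog.differentiableAt (by simp)),
      pd_log hζd hζ0.ne']
    ring
  have hpdpdF : ∀ j, pd j (pd j F) y = β * pd j (pd j w) y -
      2 * ((ζ y)⁻¹ * pd j (pd j ζ) y - ((ζ y)⁻¹ * pd j ζ y) ^ 2) := by
    intro j
    rw [hF, pd_pd_add hsub contDiffAt_const, pd_pd_const, pd_pd_sub hβw h2log,
      pd_pd_const_mul hwy.1, pd_pd_const_mul hlog, pd_pd_log hζ hζ0.ne']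
    ring
  have hL : ContDiffAt ℝ 1 (fun x => -(∑ i, pd i w x ^ 2) - Real.exp (k * w x)) y := by
    refine (ContDiffAt.neg (ContDiffAt.sum fun i _ => ?_)).sub (hek.of_le (by norm_num))
    exact (ContDiffAt.pd (m := 1) (k := 2) hwy.1 le_rfl i).pow 2
  have hmax' : IsLocalMax (fun x => ∑ i, pd i w x ^ 2 +
      (c * Real.exp (k * w x) - Real.exp (F x))) y := by
    filter_upwards [hmax, hζ.continuousAt.eventually (lt_mem_nhds hζ0)] with x hx hζx
    rw [hFy, hexpF x hζx]
    have hpos : 0 < ζ x ^ 2 * Real.exp (-(β * w x)) := by positivity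
    have : ∑ i, pd i w x ^ 2 + c * Real.exp (k * w x) ≤
        Λ / (ζ x ^ 2 * Real.exp (-(β * w x))) := by
      rw [le_div_iff₀ hpos, mul_comm]
      exact hx
    linarith
  obtain ⟨h1, h2⟩ := bochner_at_max hwy.1 (hcek.sub heF) hL (hw.mono fun x hx => hx.2) hmax'
  have hpdS : ∀ j, pd j (fun x => c * Real.exp (k * w x) - Real.exp (F x)) y =
      c * k * Real.exp (k * w y) * pd j w y -
        H * (β * pd j w y - 2 * ((ζ y)⁻¹ * pd j ζ y)) := by
    intro j
    rw [pd_sub (hcek.differentiableAt (by simp)) (heF.differentiableAt (by simp)),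
      pd_const_mul (hek.differentiableAt (by simp)), pd_exp (hkw.differentiableAt (by simp)),
      pd_exp (hFc.differentiableAt (by simp)), pd_const_mul hwd, hFy, hpdF]
    ring
  have hpdpdS : ∀ j, pd j (pd j fun x => c * Real.exp (k * w x) - Real.exp (F x)) y =
      c * Real.exp (k * w y) * (k * pd j (pd j w) y + k ^ 2 * pd j w y ^ 2) -
        H * (β * pd j (pd j w) y -
          2 * ((ζ y)⁻¹ * pd j (pd j ζ) y - ((ζ y)⁻¹ * pd j ζ y) ^ 2) +
          (β * pd j w y - 2 * ((ζ y)⁻¹ * pd j ζ y)) ^ 2) := by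
    intro j
    rw [pd_pd_sub hcek heF, pd_pd_const_mul hek, pd_pd_exp hkw, pd_pd_exp hFc,
      pd_pd_const_mul hwy.1, pd_const_mul hwd, hFy, hpdF, hpdpdF]
    ring
  simp_rw [pd_logSol_rhs hwy.1, hpdpdS] at h2
  simp_rw [hpdS] at h1
  have hsum : ∑ j, (c * Real.exp (k * w y) * (k * pd j (pd j w) y + k ^ 2 * pd j w y ^ 2) -
        H * (β * pd j (pd j w) y -
          2 * ((ζ y)⁻¹ * pd j (pd j ζ) y - ((ζ y)⁻¹ * pd j ζ y) ^ 2) +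
          (β * pd j w y - 2 * ((ζ y)⁻¹ * pd j ζ y)) ^ 2)) =
      c * Real.exp (k * w y) * (k * (-(∑ i, pd i w y ^ 2) - Real.exp (k * w y)) +
        k ^ 2 * ∑ i, pd i w y ^ 2) -
      H * (β * (-(∑ i, pd i w y ^ 2) - Real.exp (k * w y)) -
        2 * ((ζ y)⁻¹ * ∑ j, pd j (pd j ζ) y - ∑ j, ((ζ y)⁻¹ * pd j ζ y) ^ 2) +
        ∑ j, (β * pd j w y - 2 * ((ζ y)⁻¹ * pd j ζ y)) ^ 2) := by
    rw [← hwy.2]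
    simp only [Finset.sum_sub_distrib, Finset.sum_add_distrib, ← Finset.mul_sum]
  rw [hsum] at h2
  have key := bernstein_algebra (a₁ := a₁) (a₂ := a₂) (b := b) hN (fun i j => pd j (pd i w) y)
    (fun i => pd i w y) (fun j => (ζ y)⁻¹ * pd j ζ y) hH hwy.2 h1 h2
  have hh : 0 < Real.exp (k * w y) := Real.exp_pos _
  have hGy := hG0 y
  refine bernstein_final hδ hc (by linarith) (by linarith) hHpos ?_
    (fun η hη => mul_sum_le_young (fun i => pd i w y) (fun j => (ζ y)⁻¹ * pd j ζ y)
      (4 * b - 4 - 4 * β) hη) (((hQ _ _ hGy hh.le).trans key).trans_eq ?_)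
  · rw [hH]
    nlinarith [mul_nonneg hc.le hGy]
  · ring

/-- Interior estimate for `u^{-β} (|∇ log u|² + c u^k)` on balls. -/
theorem interior_estimate {N k β c a₁ a₂ b δ : ℝ} (hN : (n : ℝ) ≤ N) (hc : 0 < c) (hδ : 0 < δ)
    (hQ : ∀ G h : ℝ, 0 ≤ G → 0 ≤ h → δ * (G + h) ^ 2 ≤ bernsteinForm N k β c a₁ a₂ b G h) :
    ∃ C > 0, ∀ (w : E n → ℝ) (y₀ : E n) (ρ : ℝ), 0 < ρ → (∀ x ∈ closedBall y₀ ρ, LogSol k w x) →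
      ∃ y ∈ ball y₀ ρ, Real.exp (-(β * w y₀)) *
        (∑ i, pd i w y₀ ^ 2 + c * Real.exp (k * w y₀)) ≤
        Real.exp (-(β * w y)) * (C / ρ ^ 2) := by
  set B := (4 * b - 4 - 4 * β) ^ 2 * (1 + c) / (2 * δ) with hB
  have hB0 : 0 ≤ B := by positivity
  refine ⟨(1 + c) * (2 * (1 + c) / δ * (4 * B + 24 + 4 * n)), by positivity,
    fun w y₀ ρ hρ hw => ?_⟩
  set ζ : E n → ℝ := fun x => 1 - (ρ ^ 2)⁻¹ * sqDist y₀ x with hζ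
  have hζc : ContDiff ℝ 2 ζ := contDiff_const.sub (contDiff_const.mul (contDiff_sqDist y₀))
  set Z : E n → ℝ := fun x => ζ x ^ 2 * Real.exp (-(β * w x)) *
      (∑ i, pd i w x ^ 2 + c * Real.exp (k * w x)) with hZ
  have hZcont : ContinuousOn Z (closedBall y₀ ρ) := by
    intro x hx
    refine ContinuousAt.continuousWithinAt ?_
    have h1 : ContinuousAt w x := (hw x hx).1.continuousAt
    have h2 : ∀ i, ContinuousAt (pd i w) x := fun i =>
      (ContDiffAt.pd (m := 1) (k := 2) (hw x hx).1 le_rfl i).continuousAt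
    have h3 : ContinuousAt ζ x := hζc.continuous.continuousAt
    exact ((h3.pow 2).mul (continuousAt_const.mul h1).neg.rexp).mul
      ((tendsto_finsetSum _ fun i _ => (h2 i).pow 2).add
        (continuousAt_const.mul (continuousAt_const.mul h1).rexp))
  obtain ⟨y, hy, hymax⟩ := (isCompact_closedBall y₀ ρ).exists_isMaxOn
    ⟨y₀, mem_closedBall_self hρ.le⟩ hZcont
  have hζ₀ : ζ y₀ = 1 := by simp [hζ, sqDist_eq]
  have hG0 : ∀ x, 0 ≤ ∑ i, pd i w x ^ 2 := fun x => by positivity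
  have hHpos : ∀ x, 0 < ∑ i, pd i w x ^ 2 + c * Real.exp (k * w x) := fun x => by
    have := hG0 x; positivity
  have hZ₀ : Z y₀ = Real.exp (-(β * w y₀)) *
      (∑ i, pd i w y₀ ^ 2 + c * Real.exp (k * w y₀)) := by
    simp only [hZ, hζ₀]; ring
  have hZ₀y : Z y₀ ≤ Z y := hymax (mem_closedBall_self hρ.le)
  have hZpos : 0 < Z y := lt_of_lt_of_le (by rw [hZ₀]; have := hHpos y₀; positivity) hZ₀y
  have hyball : y ∈ ball y₀ ρ := by
    rw [mem_ball]
    refine lt_of_le_of_ne (mem_closedBall.1 hy) fun h => hZpos.ne' ?_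
    have : ζ y = 0 := by
      simp only [hζ, sqDist_eq, h]; field_simp; ring
    simp [hZ, this]
  have hζy : ζ y = 1 - (ρ ^ 2)⁻¹ * dist y y₀ ^ 2 := by simp only [hζ, sqDist_eq]
  have hdist : dist y y₀ ^ 2 < ρ ^ 2 := by
    have := mem_ball.1 hyball
    have h0 : 0 ≤ dist y y₀ := dist_nonneg
    nlinarith
  have hζpos : 0 < ζ y := by
    rw [hζy, sub_pos, inv_mul_lt_iff₀ (by positivity)]
    linarith
  have hζle : ζ y ≤ 1 := by
    rw [hζy]
    have : 0 ≤ (ρ ^ 2)⁻¹ * dist y y₀ ^ 2 := by positivity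
    linarith
  refine ⟨y, hyball, ?_⟩
  have hnhds : closedBall y₀ ρ ∈ 𝓝 y :=
    mem_of_superset (isOpen_ball.mem_nhds hyball) ball_subset_closedBall
  have hest := bernstein_at_max hN hc hδ hQ (mem_of_superset hnhds hw) hζc.contDiffAt hζpos
    (hymax.isLocalMax hnhds)
  have hsq : ContDiff ℝ 2 (sqDist y₀) := contDiff_sqDist y₀
  have hsqd : DifferentiableAt ℝ (sqDist y₀) y := hsq.contDiffAt.differentiableAt (by simp)
  have hpdζ : ∀ j, pd j ζ y = -((ρ ^ 2)⁻¹ * (2 * (y j - y₀ j))) := by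
    intro j
    rw [hζ, pd_sub (by fun_prop) (hsqd.const_mul _), pd_const, pd_const_mul hsqd, pd_sqDist]
    ring
  have hpdpdζ : ∀ j, pd j (pd j ζ) y = -((ρ ^ 2)⁻¹ * 2) := by
    intro j
    rw [hζ, pd_pd_sub contDiffAt_const (contDiffAt_const.mul hsq.contDiffAt), pd_pd_const,
      pd_pd_const_mul hsq.contDiffAt, pd_pd_sqDist]
    ring
  have hq : ∑ j, ((ζ y)⁻¹ * pd j ζ y) ^ 2 = 4 * dist y y₀ ^ 2 / (ζ y ^ 2 * (ρ ^ 2) ^ 2) := by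
    rw [← sqDist_eq, sqDist]
    simp_rw [hpdζ]
    rw [Finset.mul_sum, Finset.sum_div]
    refine Finset.sum_congr rfl fun j _ => ?_
    field_simp
    ring
  have hqle : ζ y ^ 2 * ∑ j, ((ζ y)⁻¹ * pd j ζ y) ^ 2 ≤ 4 / ρ ^ 2 := by
    rw [hq]
    have e : ζ y ^ 2 * (4 * dist y y₀ ^ 2 / (ζ y ^ 2 * (ρ ^ 2) ^ 2)) =
        4 / ρ ^ 2 * (dist y y₀ ^ 2 / ρ ^ 2) := by field_simp
    rw [e]
    have : dist y y₀ ^ 2 / ρ ^ 2 ≤ 1 := (div_le_one (by positivity)).2 hdist.le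
    exact mul_le_of_le_one_right (by positivity) this
  have hz : ζ y ^ 2 * (-2 * ((ζ y)⁻¹ * ∑ j, pd j (pd j ζ) y)) ≤ 4 * n / ρ ^ 2 := by
    simp_rw [hpdpdζ]
    rw [Finset.sum_const, Finset.card_univ, Fintype.card_fin, nsmul_eq_mul]
    have e : ζ y ^ 2 * (-2 * ((ζ y)⁻¹ * (n * -((ρ ^ 2)⁻¹ * 2)))) = 4 * n / ρ ^ 2 * ζ y := by
      field_simp; ring
    rw [e]
    exact mul_le_of_le_one_right (by positivity) hζle
  have hs : ζ y ^ 2 * (∑ i, pd i w y ^ 2 + Real.exp (k * w y)) ≤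
      2 * (1 + c) / δ * (4 * B + 24 + 4 * n) / ρ ^ 2 := by
    have h1 := mul_le_mul_of_nonneg_left hest (sq_nonneg (ζ y))
    refine h1.trans ?_
    set Q := ∑ j, ((ζ y)⁻¹ * pd j ζ y) ^ 2
    set D := (ζ y)⁻¹ * ∑ j, pd j (pd j ζ) y
    have h2 : B * (ζ y ^ 2 * Q) ≤ B * (4 / ρ ^ 2) := mul_le_mul_of_nonneg_left hqle hB0
    have h3 : B * (ζ y ^ 2 * Q) + 6 * (ζ y ^ 2 * Q) + ζ y ^ 2 * (-2 * D) ≤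
      B * (4 / ρ ^ 2) + 6 * (4 / ρ ^ 2) + 4 * n / ρ ^ 2 := by linarith
    have h4 := mul_le_mul_of_nonneg_left h3 (show 0 ≤ 2 * (1 + c) / δ by positivity)
    calc _ = 2 * (1 + c) / δ * (B * (ζ y ^ 2 * Q) + 6 * (ζ y ^ 2 * Q) + ζ y ^ 2 * (-2 * D)) := by
          ring
      _ ≤ _ := h4
      _ = _ := by ring
  rw [← hZ₀]
  refine hZ₀y.trans ?_
  have hHs : ∑ i, pd i w y ^ 2 + c * Real.exp (k * w y) ≤
      (1 + c) * (∑ i, pd i w y ^ 2 + Real.exp (k * w y)) := by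
    have := mul_nonneg hc.le (hG0 y)
    have := Real.exp_pos (k * w y)
    linarith
  calc Z y = Real.exp (-(β * w y)) *
        (ζ y ^ 2 * (∑ i, pd i w y ^ 2 + c * Real.exp (k * w y))) := by simp only [hZ]; ring
    _ ≤ Real.exp (-(β * w y)) *
        (ζ y ^ 2 * ((1 + c) * (∑ i, pd i w y ^ 2 + Real.exp (k * w y)))) := by gcongr
    _ = Real.exp (-(β * w y)) *
        ((1 + c) * (ζ y ^ 2 * (∑ i, pd i w y ^ 2 + Real.exp (k * w y)))) := by ring
    _ ≤ Real.exp (-(β * w y)) *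
        ((1 + c) * (2 * (1 + c) / δ * (4 * B + 24 + 4 * n) / ρ ^ 2)) := by gcongr
    _ = _ := by ring

theorem exists_quadratic_lower_bound {A B D : ℝ} (hA : 0 < A) (hB : 0 < B) (hD : 0 < D) :
    ∃ δ > 0, ∀ G h : ℝ, 0 ≤ G → 0 ≤ h → δ * (G + h) ^ 2 ≤ A * G ^ 2 + B * (G * h) + D * h ^ 2 := by
  refine ⟨min A (min (B / 2) D), by positivity, fun G h hG hh => ?_⟩
  set δ := min A (min (B / 2) D)
  have h1 : δ ≤ A := min_le_left _ _
  have h2 : δ ≤ B / 2 := (min_le_right _ _).trans (min_le_left _ _)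
  have h3 : δ ≤ D := (min_le_right _ _).trans (min_le_right _ _)
  nlinarith [mul_le_mul_of_nonneg_right h1 (sq_nonneg G), mul_le_mul_of_nonneg_right h3 (sq_nonneg h),
    mul_le_mul_of_nonneg_right h2 (mul_nonneg hG hh)]

theorem exists_bernstein_exponent {N k : ℝ} (hN : 2 ≤ N) (hk : 0 < k) (hNk : (N - 2) * k < 4) :
    ∃ β, 0 < β ∧ β < k ∧ (N - 2) * β < 2 ∧ 0 < 6 - 2 * k * (N - 1) + (N + 2) * β := by
  have hN2 : 0 < N + 2 := by linarith
  set l := max 0 ((2 * (N - 1) * k - 6) / (N + 2)) with hl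
  have hlk : l < k := by
    refine max_lt hk ?_
    rw [div_lt_iff₀ hN2]
    nlinarith
  have hl2 : (N - 2) * l < 2 := by
    rcases max_choice 0 ((2 * (N - 1) * k - 6) / (N + 2)) with h | h
    · rw [hl, h]; norm_num
    · rw [hl, h, ← mul_div_assoc, div_lt_iff₀ hN2]
      nlinarith [mul_nonneg (sub_nonneg.2 hN) hk.le]
  have h1 : l < (l + k) / 2 := by linarith
  obtain ⟨β, hlβ, hβk, hβ2⟩ : ∃ β, l < β ∧ β < k ∧ (N - 2) * β < 2 := by
    rcases hN.eq_or_lt with h | h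
    · exact ⟨(l + k) / 2, by linarith, by linarith, by rw [← h]; norm_num⟩
    · have hpos : 0 < N - 2 := by linarith
      have : l < min k (2 / (N - 2)) := lt_min hlk ((lt_div_iff₀ hpos).2 (by linarith))
      obtain ⟨β, h1, h2⟩ := exists_between this
      refine ⟨β, h1, h2.trans_le (min_le_left _ _), ?_⟩
      have := h2.trans_le (min_le_right _ _)
      rw [lt_div_iff₀ hpos] at this
      linarith
  refine ⟨β, (le_max_left _ _).trans_lt hlβ, hβk, hβ2, ?_⟩
  have := (le_max_right _ _).trans_lt hlβ
  rw [div_lt_iff₀ hN2] at this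
  linarith

theorem exists_bernstein_parameters {N k : ℝ} (hN : 2 ≤ N) (hk : 0 < k) (hNk : (N - 2) * k < 4) :
    ∃ β c a₁ a₂ b δ : ℝ, 0 < β ∧ (N - 2) * β < 2 ∧ 0 < c ∧ 0 < δ ∧
      ∀ G h : ℝ, 0 ≤ G → 0 ≤ h → δ * (G + h) ^ 2 ≤ bernsteinForm N k β c a₁ a₂ b G h := by
  obtain ⟨β, hβ, hβk, hβ2, hD⟩ := exists_bernstein_exponent hN hk hNk
  have hN0 : 0 < N := by linarith
  have hN1 : 0 < N - 1 := by linarith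
  have hkβ : 0 < k - β := by linarith
  set b := (N * β / 2 + 1) / (N - 1) with hb
  set e := 2 / N * (2 * b - 1 - k - β) with he
  set D := (6 - 2 * k * (N - 1) + (N + 2) * β) / N with hDdef
  have hDpos : 0 < D := by positivity
  set ε := min (1 / 2) (D / (2 * (|e| + 1))) with hε
  have hεpos : 0 < ε := by positivity
  have hε1 : ε ≤ 1 / 2 := min_le_left _ _
  have hεe : ε * |e| ≤ D / 2 := by
    have h1 : ε * (|e| + 1) ≤ D / 2 := by
      have := min_le_right (1 / 2) (D / (2 * (|e| + 1)))
      rw [← hε, le_div_iff₀ (by positivity)] at this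
      linarith
    linarith
  have hcross : 0 < D + ε * e := by
    have := mul_le_mul_of_nonneg_left (neg_abs_le e) hεpos.le
    linarith
  have hA : 0 < (2 - (N - 2) * β) * (2 + β) / (2 * (N - 1)) := by
    have : 0 < 2 - (N - 2) * β := by linarith
    positivity
  obtain ⟨δ, hδ, hq⟩ := exists_quadratic_lower_bound hA hcross
    (show 0 < 2 * ε / N by positivity)
  refine ⟨β, (1 - ε) * 2 / (N * (k - β)), -(1 + β / 2) / (N - 1), -1 / N, b, δ, hβ, hβ2, ?_, hδ,
    fun G h hG hh => (hq G h hG hh).trans_eq ?_⟩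
  · have : 0 < 1 - ε := by linarith
    positivity
  · set c := (1 - ε) * 2 / (N * (k - β)) with hc
    have hm : c * (k - β) = (1 - ε) * 2 / N := by rw [hc]; field_simp
    have e1 : bernsteinForm N k β c (-(1 + β / 2) / (N - 1)) (-1 / N) b G h =
        (2 - (N - 2) * β) * (2 + β) / (2 * (N - 1)) * G ^ 2 +
        (4 / N + 4 * b / N - (2 * b - 1) * (c * (k - β)) - 2 * k + β +
          c * (k - β) * (k + β)) * (G * h) + (2 / N - c * (k - β)) * h ^ 2 := by
      clear_value c
      unfold bernsteinForm
      rw [hb]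
      field_simp
      ring
    rw [e1, hm, he, hDdef]
    clear_value b ε
    field_simp
    ring

theorem norm_fderiv_sq_le (f : E n → ℝ) (x : E n) :
    ‖fderiv ℝ f x‖ ^ 2 ≤ ∑ i, pd i f x ^ 2 := by
  refine (sq_le_sq₀ (norm_nonneg _) (Real.sqrt_nonneg _)).2
    (ContinuousLinearMap.opNorm_le_bound _ (Real.sqrt_nonneg (∑ i, pd i f x ^ 2)) fun v => ?_)
    |>.trans_eq (Real.sq_sqrt (by positivity))
  have hv : fderiv ℝ f x v = ∑ i, pd i f x * v i := by
    conv_lhs => rw [← (EuclideanSpace.basisFun (Fin n) ℝ).sum_repr v]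
    simp only [map_sum, map_smul, pd, smul_eq_mul, EuclideanSpace.basisFun_repr,
      EuclideanSpace.basisFun_apply, mul_comm]
  rw [hv, EuclideanSpace.norm_eq, ← Real.sqrt_mul (by positivity), Real.norm_eq_abs]
  refine Real.abs_le_sqrt ?_
  simpa using Finset.sum_mul_sq_le_sq_mul_sq Finset.univ (fun i => pd i f x) (fun i => v i)

theorem abs_sub_le_of_grad_le {w : E n → ℝ} {y : E n} {r B : ℝ} (hr : 0 ≤ r) (hB : 0 ≤ B)
    (hw : ∀ x ∈ closedBall y r, DifferentiableAt ℝ w x)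
    (hG : ∀ x ∈ closedBall y r, ∑ i, pd i w x ^ 2 ≤ B ^ 2) {x : E n} (hx : x ∈ closedBall y r) :
    |w x - w y| ≤ B * r := by
  have := (convex_closedBall y r).norm_image_sub_le_of_norm_fderiv_le (𝕜 := ℝ) hw
    (fun z hz => (sq_le_sq₀ (norm_nonneg _) hB).1 ((norm_fderiv_sq_le w z).trans (hG z hz)))
    (mem_closedBall_self hr) hx
  refine this.trans (mul_le_mul_of_nonneg_left ?_ hB)
  rwa [← dist_eq_norm, ← mem_closedBall]

/-- Comparison of the superharmonic function `e^w` with a power of the distance on an annulus. -/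
theorem annulus_comparison {k η M r ρ : ℝ} (hη : 0 < η) (hηn : (n : ℝ) - 2 ≤ η) (hr : 0 < r)
    {w : E n → ℝ} {y : E n} (hw : ∀ x ∈ closedBall y ρ, LogSol k w x)
    (hM : ∀ x ∈ closedBall y r, M ≤ w x) {x : E n} (hrx : r ≤ dist x y) (hxρ : dist x y ≤ ρ) :
    Real.exp (M + η * Real.log r - η * Real.log (dist x y)) -
      Real.exp (M + η * Real.log r - η * Real.log ρ) ≤ Real.exp (w x) := by
  set a := M + η * Real.log r with ha
  set f : E n → ℝ := fun z => a - η / 2 * Real.log (sqDist y z) with hf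
  have hfd : ∀ z, f z = a - η * Real.log (dist z y) := by
    intro z
    simp only [hf, sqDist_eq, Real.log_pow]
    push_cast; ring
  set g : E n → ℝ := fun z => Real.exp (f z) - Real.exp (w z) with hg
  set K : Set (E n) := closedBall y ρ ∩ (ball y r)ᶜ with hK
  have hKc : IsCompact K := (isCompact_closedBall y ρ).inter_right isOpen_ball.isClosed_compl
  have hs0 : ∀ z ∈ K, 0 < sqDist y z := by
    intro z hz
    have h1 : r ≤ dist z y := by simpa using hz.2
    rw [sqDist_eq]
    have := hr.trans_le h1
    positivity
  have hfc : ∀ z ∈ K, ContDiffAt ℝ 2 f z := fun z hz =>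
    contDiffAt_const.sub (contDiffAt_const.mul ((contDiff_sqDist y).contDiffAt.log (hs0 z hz).ne'))
  have hgc : ∀ z ∈ K, ContDiffAt ℝ 2 g z := fun z hz =>
    (hfc z hz).exp.sub (hw z hz.1).1.exp
  have hxK : x ∈ K := ⟨mem_closedBall.2 hxρ, by simpa using hrx⟩
  obtain ⟨z, hz, hzmax⟩ := hKc.exists_isMaxOn ⟨x, hxK⟩
    fun z hz => (hgc z hz).continuousAt.continuousWithinAt
  have hrz : r ≤ dist z y := by simpa using hz.2
  have hzρ : dist z y ≤ ρ := hz.1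
  suffices h : g z ≤ Real.exp (a - η * Real.log ρ) by
    have h1 : g x ≤ g z := hzmax hxK
    simp only [hg, hfd] at h1 h
    linarith
  simp only [hg, hfd]
  have hexp := Real.exp_pos (w z)
  rcases hrz.eq_or_lt with hrz' | hrz'
  · have h1 : Real.exp (a - η * Real.log (dist z y)) = Real.exp M := by
      rw [← hrz', ha]; ring_nf
    have h2 := Real.exp_le_exp.2 (hM z (mem_closedBall.2 hrz'.ge))
    have h3 := Real.exp_pos (a - η * Real.log ρ)
    linarith
  rcases hzρ.eq_or_lt with hzρ' | hzρ'
  · rw [hzρ']; linarith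
  exfalso
  have hnhds : K ∈ 𝓝 z := by
    have h1 : ball y ρ ∩ (closedBall y r)ᶜ ∈ 𝓝 z :=
      (isOpen_ball.inter isClosed_closedBall.isOpen_compl).mem_nhds
        ⟨mem_ball.2 hzρ', by simpa using hrz'⟩
    exact mem_of_superset h1 (inter_subset_inter ball_subset_closedBall
      (compl_subset_compl.2 ball_subset_closedBall))
  have hwz := hw z hz.1
  have hsq : ContDiffAt ℝ 2 (sqDist y) z := (contDiff_sqDist y).contDiffAt
  have hlog : ContDiffAt ℝ 2 (fun z => Real.log (sqDist y z)) z := hsq.log (hs0 z hz).ne'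
  have hclog : ContDiffAt ℝ 2 (fun z => η / 2 * Real.log (sqDist y z)) z :=
    contDiffAt_const.mul hlog
  have hpd : ∀ j, pd j f z = -(η * (sqDist y z)⁻¹ * (z j - y j)) := by
    intro j
    rw [hf, pd_sub (by fun_prop) (hclog.differentiableAt (by simp)), pd_const,
      pd_const_mul (hlog.differentiableAt (by simp)),
      pd_log (hsq.differentiableAt (by simp)) (hs0 z hz).ne', pd_sqDist]
    ring
  have hpdpd : ∀ j, pd j (pd j f) z =
      -(η / 2) * ((sqDist y z)⁻¹ * 2 - 4 * (sqDist y z)⁻¹ ^ 2 * (z j - y j) ^ 2) := by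
    intro j
    rw [hf, pd_pd_sub contDiffAt_const hclog, pd_pd_const, pd_pd_const_mul hlog,
      pd_pd_log hsq (hs0 z hz).ne', pd_pd_sqDist, pd_sqDist]
    ring
  have hsum : ∑ j, (pd j (pd j f) z + pd j f z ^ 2) = η * (η - (n - 2)) * (sqDist y z)⁻¹ := by
    have e : ∀ j, pd j (pd j f) z + pd j f z ^ 2 = -η * (sqDist y z)⁻¹ +
        (2 * η + η ^ 2) * (sqDist y z)⁻¹ ^ 2 * (z j - y j) ^ 2 := by
      intro j; rw [hpd, hpdpd]; ring
    simp_rw [e]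
    rw [Finset.sum_add_distrib, Finset.sum_const, Finset.card_univ, Fintype.card_fin,
      nsmul_eq_mul, ← Finset.mul_sum]
    have e2 : ∑ j, (z j - y j) ^ 2 = sqDist y z := rfl
    rw [e2]
    have := (hs0 z hz).ne'
    field_simp
    ring
  have hlapf : 0 ≤ ∑ j, pd j (pd j fun z => Real.exp (f z)) z := by
    simp_rw [pd_pd_exp (hfc z hz)]
    rw [← Finset.mul_sum, hsum]
    have := hs0 z hz
    have : 0 ≤ η - (n - 2) := by linarith
    positivity
  have hlapw : ∑ j, pd j (pd j fun z => Real.exp (w z)) z < 0 := by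
    simp_rw [pd_pd_exp hwz.1]
    rw [← Finset.mul_sum, Finset.sum_add_distrib, hwz.2]
    have := Real.exp_pos (k * w z)
    exact mul_neg_of_pos_of_neg hexp (by linarith)
  have hlapg : ∑ j, pd j (pd j g) z ≤ 0 := Finset.sum_nonpos fun j _ =>
    IsLocalMax.pd_pd_nonpos (hgc z hz) (hzmax.isLocalMax hnhds) j
  simp_rw [hg, pd_pd_sub (hfc z hz).exp hwz.1.exp] at hlapg
  rw [Finset.sum_sub_distrib] at hlapg
  linarith

theorem log_lower_bound {η : ℝ} (hη : 0 < η) (hηn : (n : ℝ) - 2 ≤ η) :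
    ∃ L : ℝ, ∀ (k M r ρ : ℝ) (w : E n → ℝ) (y : E n), 0 < r → 2 * r ≤ ρ →
      (∀ x ∈ closedBall y ρ, LogSol k w x) → (∀ x ∈ closedBall y r, M ≤ w x) →
      ∀ x ∈ closedBall y (ρ / 2), M - L - η * Real.log (ρ / r) ≤ w x := by
  have h2 : 0 < (2 : ℝ) ^ η - 1 := by
    have := Real.one_lt_rpow (one_lt_two) hη
    linarith
  refine ⟨-Real.log (min 1 ((2 : ℝ) ^ η - 1)), fun k M r ρ w y hr hρ hw hM x hx => ?_⟩
  have hρ0 : 0 < ρ := by linarith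
  have hlogpos : 0 ≤ Real.log (ρ / r) := Real.log_nonneg ((one_le_div hr).2 (by linarith))
  set m := min 1 ((2 : ℝ) ^ η - 1) with hm
  have hm0 : 0 < m := lt_min one_pos h2
  rcases le_total (dist x y) r with hxr | hxr
  · have h1 : Real.log m ≤ 0 := Real.log_nonpos hm0.le (min_le_left _ _)
    have h3 := hM x (mem_closedBall.2 hxr)
    have := mul_nonneg hη.le hlogpos
    linarith
  · have hxd : dist x y ≤ ρ / 2 := hx
    have h3 := annulus_comparison hη hηn hr hw hM hxr (by linarith)
    have hd : 0 < dist x y := hr.trans_le hxr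
    have h4 : Real.log (dist x y) ≤ Real.log ρ - Real.log 2 := by
      rw [← Real.log_div hρ0.ne' two_ne_zero]
      exact Real.log_le_log hd hxd
    have h5 : Real.exp (M + η * Real.log r - η * Real.log ρ + η * Real.log 2) ≤
        Real.exp (M + η * Real.log r - η * Real.log (dist x y)) := by
      rw [Real.exp_le_exp]
      nlinarith
    rw [Real.exp_add] at h5
    have h6 : Real.exp (η * Real.log 2) = (2 : ℝ) ^ η := by
      rw [Real.rpow_def_of_pos two_pos, mul_comm]
    rw [h6] at h5
    have h7 : M - -Real.log m - η * Real.log (ρ / r) =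
        (M + η * Real.log r - η * Real.log ρ) + Real.log m := by
      rw [Real.log_div hρ0.ne' hr.ne']; ring
    rw [h7, ← Real.exp_le_exp, Real.exp_add, Real.exp_log hm0]
    have h8 : m ≤ (2 : ℝ) ^ η - 1 := min_le_right _ _
    have h9 := mul_le_mul_of_nonneg_left h8
      (Real.exp_pos (M + η * Real.log r - η * Real.log ρ)).le
    linarith

theorem exists_doubling_point {H : E n → ℝ} {x : E n} {R : ℝ} (hR : 0 < R)
    (hH : ContinuousOn H (closedBall x R)) (hpos : ∀ z ∈ closedBall x R, 0 < H z) :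
    ∃ y ρ, 0 < ρ ∧ closedBall y ρ ⊆ closedBall x R ∧ (∀ z ∈ closedBall y ρ, H z ≤ 4 * H y) ∧
      H x * R ^ 2 ≤ 4 * (H y * ρ ^ 2) := by
  have hcont : ContinuousOn (fun z => H z * (R - dist z x) ^ 2) (closedBall x R) := by fun_prop
  have hx : x ∈ closedBall x R := mem_closedBall_self hR.le
  obtain ⟨y, hy, hmax⟩ := (isCompact_closedBall x R).exists_isMaxOn ⟨x, hx⟩ hcont
  have h1 : H x * R ^ 2 ≤ H y * (R - dist y x) ^ 2 := by simpa using hmax hx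
  have hyR : dist y x < R := by
    refine lt_of_le_of_ne hy fun h => ?_
    rw [h, sub_self] at h1
    have := hpos x hx
    have : 0 < H x * R ^ 2 := by positivity
    simp at h1
    linarith
  have hsub : closedBall y ((R - dist y x) / 2) ⊆ closedBall x R :=
    closedBall_subset_closedBall' (by linarith)
  refine ⟨y, (R - dist y x) / 2, by linarith, hsub, fun z hz => ?_, by linarith⟩
  have h2 : H z * (R - dist z x) ^ 2 ≤ H y * (R - dist y x) ^ 2 := hmax (hsub hz)
  have h3 : dist z x ≤ dist z y + dist y x := dist_triangle _ _ _
  have h4 : dist z y ≤ (R - dist y x) / 2 := hz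
  have h5 : (R - dist y x) / 2 ≤ R - dist z x := by linarith
  have h6 : ((R - dist y x) / 2) ^ 2 ≤ (R - dist z x) ^ 2 :=
    pow_le_pow_left₀ (by linarith) h5 2
  have h7 := mul_le_mul_of_nonneg_left h6 (hpos z (hsub hz)).le
  have h8 : 0 < (R - dist y x) ^ 2 := by
    have : 0 < R - dist y x := by linarith
    positivity
  refine le_of_mul_le_mul_right ?_ h8
  linarith

/-- Universal bound for `|∇ log u|² + c u^k` in the subcritical range. -/
theorem exists_universal_bound {N k : ℝ} (hN : 2 ≤ N) (hnN : (n : ℝ) ≤ N) (hk : 0 < k)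
    (hNk : (N - 2) * k < 4) :
    ∃ C > 0, ∀ (w : E n → ℝ) (x : E n) (R : ℝ), 0 < R →
      (∀ z ∈ closedBall x R, LogSol k w z) → Real.exp (k * w x) * R ^ 2 ≤ C := by
  obtain ⟨β, c, a₁, a₂, b, δ, hβ, hβ2, hc, hδ, hQ⟩ := exists_bernstein_parameters hN hk hNk
  obtain ⟨C, hC, hinterior⟩ := interior_estimate hnN hc hδ hQ
  set η := ((N - 2) + 2 / β) / 2 with hη
  have hη1 : N - 2 < 2 / β := (lt_div_iff₀ hβ).2 hβ2
  have hη0 : 0 < η := by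
    have : 0 < 2 / β := by positivity
    have : 0 ≤ N - 2 := by linarith
    positivity
  have hηβ : η * β < 2 := by
    have : η < 2 / β := by rw [hη]; linarith
    exact (lt_div_iff₀ hβ).1 this
  obtain ⟨L, hL⟩ := log_lower_bound (n := n) hη0 (by rw [hη]; linarith)
  set K := 4 * C * Real.exp (β * (2 + L)) with hK
  have hK0 : 0 < K := by positivity
  set M := max 4 (Real.exp (2 * (Real.log K / (2 - η * β)))) with hM
  have hM4 : 4 ≤ M := le_max_left _ _
  refine ⟨4 * M / c, by positivity, fun w x R hR hw => ?_⟩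
  set H : E n → ℝ := fun z => ∑ i, pd i w z ^ 2 + c * Real.exp (k * w z) with hH
  have hG0 : ∀ z, 0 ≤ ∑ i, pd i w z ^ 2 := fun z => by positivity
  have hHpos : ∀ z, 0 < H z := fun z => by
    have := hG0 z
    simp only [hH]
    positivity
  have hHcont : ContinuousOn H (closedBall x R) := by
    intro z hz
    refine ContinuousAt.continuousWithinAt ?_
    have h2 : ∀ i, ContinuousAt (pd i w) z := fun i =>
      (ContDiffAt.pd (m := 1) (k := 2) (hw z hz).1 le_rfl i).continuousAt
    exact (tendsto_finsetSum _ fun i _ => (h2 i).pow 2).add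
      (continuousAt_const.mul (continuousAt_const.mul (hw z hz).1.continuousAt).rexp)
  obtain ⟨y, ρ, hρ, hsub, hdouble, hxy⟩ :=
    exists_doubling_point hR hHcont fun z _ => hHpos z
  have key : H y * ρ ^ 2 ≤ M := by
    by_contra! hcon
    set A := H y with hA
    have hApos : 0 < A := hHpos y
    set s := √A with hs
    have hspos : 0 < s := Real.sqrt_pos.2 hApos
    have hsA : s ^ 2 = A := Real.sq_sqrt hApos.le
    have hX2 : 2 ≤ ρ * s := by
      refine (sq_le_sq₀ zero_le_two (by positivity)).1 ?_
      rw [mul_pow, hsA]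
      linarith
    have hrρ : 2 * s⁻¹ ≤ ρ := by
      rw [← div_eq_mul_inv, div_le_iff₀ hspos]
      exact hX2
    have hsinv : s⁻¹ ≤ ρ := by
      have : 0 < s⁻¹ := by positivity
      linarith
    have hwρ : ∀ z ∈ closedBall y ρ, LogSol k w z := fun z hz => hw z (hsub hz)
    have hlow : ∀ z ∈ closedBall y s⁻¹, w y - 2 ≤ w z := by
      intro z hz
      have hsub2 : closedBall y s⁻¹ ⊆ closedBall y ρ := closedBall_subset_closedBall hsinv
      have h1 := abs_sub_le_of_grad_le (w := w) (B := 2 * s) (by positivity) (by positivity)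
        (fun v hv => (hwρ v (hsub2 hv)).1.differentiableAt (by simp)) (fun v hv => ?_) hz
      · rw [mul_assoc, mul_inv_cancel₀ hspos.ne', mul_one] at h1
        linarith [(abs_le.1 h1).1]
      · have h2 := hdouble v (hsub2 hv)
        have h3 : 0 < c * Real.exp (k * w v) := by positivity
        rw [mul_pow, hsA]
        simp only [hH] at h2
        linarith
    have hwlow := hL k (w y - 2) s⁻¹ ρ w y (by positivity) hrρ hwρ hlow
    obtain ⟨v, hv, hest⟩ := hinterior w y (ρ / 2) (by positivity) fun z hz =>
      hwρ z (closedBall_subset_closedBall (by linarith) hz)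
    have hv2 := hwlow v (ball_subset_closedBall hv)
    rw [div_inv_eq_mul] at hv2
    set ℓ := Real.log (ρ * s) with hℓ
    have hexpℓ : Real.exp (2 * ℓ) = A * ρ ^ 2 := by
      rw [two_mul, Real.exp_add, Real.exp_log (by positivity), ← hsA]; ring
    have h1 : A ≤ Real.exp (β * w y + -(β * w v)) * (C / (ρ / 2) ^ 2) := by
      have := mul_le_mul_of_nonneg_left hest (Real.exp_pos (β * w y)).le
      rw [← mul_assoc, ← Real.exp_add, add_neg_cancel, Real.exp_zero, one_mul, ← mul_assoc,
        ← Real.exp_add] at this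
      exact this
    have h2 : Real.exp (β * w y + -(β * w v)) ≤
        Real.exp (β * (2 + L)) * Real.exp (η * β * ℓ) := by
      rw [← Real.exp_add, Real.exp_le_exp]
      nlinarith
    have h3 : A * ρ ^ 2 ≤ K * Real.exp (η * β * ℓ) := by
      have h4 : A ≤ Real.exp (β * (2 + L)) * Real.exp (η * β * ℓ) * (C / (ρ / 2) ^ 2) :=
        h1.trans (mul_le_mul_of_nonneg_right h2 (by positivity))
      have h5 := mul_le_mul_of_nonneg_right h4 (sq_nonneg ρ)
      refine h5.trans_eq ?_
      rw [hK]
      field_simp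
      ring
    rw [← hexpℓ, ← Real.exp_log hK0, ← Real.exp_add, Real.exp_le_exp] at h3
    have h6 : ℓ ≤ Real.log K / (2 - η * β) := by
      rw [le_div_iff₀ (by linarith)]
      linarith
    have h7 : A * ρ ^ 2 ≤ M := by
      rw [← hexpℓ]
      exact (Real.exp_le_exp.2 (by linarith)).trans (le_max_right _ _)
    linarith
  have hxle : c * Real.exp (k * w x) ≤ H x := by
    have := hG0 x
    simp only [hH]
    linarith
  have h8 := mul_le_mul_of_nonneg_right hxle (sq_nonneg R)
  rw [le_div_iff₀ hc]
  linarith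

theorem logSol_log {α : ℝ} {u : E n → ℝ} {x : E n} (hu : ContDiffAt ℝ 2 u x) (hpos : 0 < u x)
    (heq : lap u x + u x ^ α = 0) : LogSol (α - 1) (fun z => Real.log (u z)) x := by
  refine ⟨hu.log hpos.ne', ?_⟩
  simp_rw [pd_pd_log hu hpos.ne', pd_log (hu.differentiableAt (by simp)) hpos.ne']
  rw [Finset.sum_sub_distrib, ← Finset.mul_sum, ← lap_eq hu, eq_neg_of_add_eq_zero_left heq]
  have h1 : Real.exp ((α - 1) * Real.log (u x)) = (u x)⁻¹ * u x ^ α := by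
    rw [mul_comm, ← Real.rpow_def_of_pos hpos, Real.rpow_sub_one hpos.ne']
    ring
  rw [h1]
  ring

end

/-- Dancer-type universal boundedness estimate: a positive solution of
`Δu + u^α = 0` on a proper open set `Ω ⊆ ℝⁿ` satisfies
`u(x) ≤ C dist(x, ℝⁿ \ Ω)^{-2/(α-1)}`. -/
theorem stmt6 (n : ℕ) (hn : 0 < n) (α : ℝ) (hα : 1 < α)
    (hαp : 2 < n → α < ((n : ℝ) + 2) / ((n : ℝ) - 2)) :
    ∃ C : ℝ, 0 < C ∧
      ∀ Ω : Set (E n), IsOpen Ω → Ω.Nonempty → Ω ≠ univ →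
        ∀ u : E n → ℝ, ContDiffOn ℝ 2 u Ω →
          (∀ x ∈ Ω, 0 < u x) →
          (∀ x ∈ Ω, lap u x + u x ^ α = 0) →
          ∀ x ∈ Ω, u x ≤ C * infDist x Ωᶜ ^ (-(2 / (α - 1))) := by
  have hk : 0 < α - 1 := by linarith
  have hNk : (max (n : ℝ) 2 - 2) * (α - 1) < 4 := by
    rcases le_or_gt n 2 with h | h
    · have : (n : ℝ) ≤ 2 := by exact_mod_cast h
      rw [max_eq_right this]
      norm_num
    · have h2 : (2 : ℝ) < n := by exact_mod_cast h
      have h3 := (lt_div_iff₀ (by linarith)).1 (hαp h)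
      rw [max_eq_left h2.le]
      linarith
  obtain ⟨C, hC, hbound⟩ := exists_universal_bound (n := n) (le_max_right (n : ℝ) 2)
    (le_max_left _ _) hk hNk
  refine ⟨(4 * C) ^ (1 / (α - 1)), by positivity, fun Ω hΩ _ hne u hu hpos heq x hx => ?_⟩
  have hcne : Ωᶜ.Nonempty := nonempty_compl.2 hne
  set d := infDist x Ωᶜ with hd
  have hdpos : 0 < d := (hΩ.isClosed_compl.notMem_iff_infDist_pos hcne).1 (by simpa using hx)
  have hsub : closedBall x (d / 2) ⊆ Ω := by
    intro z hz
    by_contra hzΩ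
    have h1 : d ≤ dist x z := infDist_le_dist_of_mem hzΩ
    have h2 : dist z x ≤ d / 2 := hz
    rw [dist_comm] at h2
    linarith
  have h1 := hbound (fun z => Real.log (u z)) x (d / 2) (by positivity) fun z hz =>
    logSol_log (hu.contDiffAt (hΩ.mem_nhds (hsub hz))) (hpos z (hsub hz)) (heq z (hsub hz))
  have hux := hpos x hx
  have h2 : u x ^ (α - 1) ≤ 4 * C * d ^ (-2 : ℝ) := by
    rw [mul_comm (α - 1), ← Real.rpow_def_of_pos hux] at h1
    rw [Real.rpow_neg hdpos.le, Real.rpow_two, ← div_eq_mul_inv, le_div_iff₀ (by positivity)]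
    linarith
  have h3 := Real.rpow_le_rpow (by positivity) h2 (show 0 ≤ 1 / (α - 1) by positivity)
  rw [← Real.rpow_mul hux.le, mul_one_div_cancel hk.ne', Real.rpow_one,
    Real.mul_rpow (by positivity) (by positivity), ← Real.rpow_mul hdpos.le] at h3
  convert h3 using 3
  ring
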